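/- For fixed integers i, j, k with k ≥ 2, j ≥ k, i ≥ 2, and with k·i - j not divisible by i - 1, the Brown–Erdős–Sós function satisfies F^(k)(n; j, i) = Ω((n^{k·i-j}·log n)^{1/(i-1)}). -/

import Mathlib

/-- The Brown–Erdős–Sós function `F^(k)(n; j, i)`: the minimum number `m` of edges such
that every `k`-uniform hypergraph on `n` vertices with `m` edges contains a set of `j`
vertices spanning at least `i` edges. -/
noncomputable def besF (k n j i : ℕ) : ℕ :=
  sInf {m | ∀ H : Finset (Finset (Fin n)), (∀ e ∈ H, e.card = k) → H.card = m →
    ∃ S : Finset (Fin n), S.card = j ∧ i ≤ (H.filter (fun e => e ⊆ S)).card}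

set_option linter.unusedSectionVars false
set_option linter.unusedVariables false
namespace BES
open Finset

section Prob
variable {V Ω : Type*} [Fintype V] [DecidableEq V] [Fintype Ω]

/-- Expectation for a finite product weight. -/
noncomputable def Ex (μ : V → Ω → ℝ) (f : (V → Ω) → ℝ) : ℝ :=
  ∑ ω, (∏ v, μ v (ω v)) * f ω

/-- Each factor is a probability vector. -/
structure IsP (μ : V → Ω → ℝ) : Prop where
  nonneg : ∀ v a, 0 ≤ μ v a
  sum_one : ∀ v, ∑ a, μ v a = 1

/-- The function depends only on the coordinates in `S`. -/
def Dep (f : (V → Ω) → ℝ) (S : Finset V) : Prop :=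
  ∀ ω ω' : V → Ω, (∀ v ∈ S, ω v = ω' v) → f ω = f ω'

variable {μ : V → Ω → ℝ}

lemma Ex_prodfun (g : V → Ω → ℝ) :
    Ex μ (fun ω => ∏ v, g v (ω v)) = ∏ v, ∑ a, μ v a * g v a := by
  unfold Ex
  rw [Finset.prod_univ_sum]
  rw [Fintype.piFinset_univ]
  refine Finset.sum_congr rfl fun ω _ => ?_
  rw [Finset.prod_mul_distrib]

lemma Ex_one (h : IsP μ) : Ex μ (fun _ => 1) = 1 := by
  have := Ex_prodfun (μ := μ) (fun _ _ => 1)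
  simpa [h.sum_one] using this

lemma Ex_single (h : IsP μ) (v : V) (g : Ω → ℝ) :
    Ex μ (fun ω => g (ω v)) = ∑ a, μ v a * g a := by
  have := Ex_prodfun (μ := μ) (fun w a => if w = v then g a else 1)
  simp only [Finset.prod_ite_eq', Finset.mem_univ, if_true] at this
  rw [this, Finset.prod_eq_single v]
  · simp
  · intro b _ hb
    simp [hb, h.sum_one]
  · simp

lemma Ex_mono (h : IsP μ) {f g : (V → Ω) → ℝ} (hfg : ∀ ω, f ω ≤ g ω) : Ex μ f ≤ Ex μ g := by
  unfold Ex
  exact Finset.sum_le_sum fun ω _ =>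
    mul_le_mul_of_nonneg_left (hfg ω) (Finset.prod_nonneg fun v _ => h.nonneg v _)

lemma Ex_sum {ι : Type*} (s : Finset ι) (f : ι → (V → Ω) → ℝ) :
    Ex μ (fun ω => ∑ i ∈ s, f i ω) = ∑ i ∈ s, Ex μ (f i) := by
  unfold Ex
  rw [Finset.sum_comm]
  simp_rw [Finset.mul_sum]

lemma Ex_add (f g : (V → Ω) → ℝ) : Ex μ (fun ω => f ω + g ω) = Ex μ f + Ex μ g := by
  unfold Ex
  simp_rw [mul_add, Finset.sum_add_distrib]

lemma Ex_sub (f g : (V → Ω) → ℝ) : Ex μ (fun ω => f ω - g ω) = Ex μ f - Ex μ g := by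
  unfold Ex
  simp_rw [mul_sub, Finset.sum_sub_distrib]

lemma Ex_cmul (c : ℝ) (f : (V → Ω) → ℝ) : Ex μ (fun ω => c * f ω) = c * Ex μ f := by
  unfold Ex
  rw [Finset.mul_sum]
  exact Finset.sum_congr rfl fun _ _ => by ring

lemma Ex_const (h : IsP μ) (c : ℝ) : Ex μ (fun _ => c) = c := by
  have := Ex_cmul (μ := μ) c (fun _ => 1)
  simpa [Ex_one h] using this

lemma Ex_nonneg (h : IsP μ) {f : (V → Ω) → ℝ} (hf : ∀ ω, 0 ≤ f ω) : 0 ≤ Ex μ f := by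
  have := Ex_mono h hf
  rwa [Ex_const h] at this

lemma Ex_exists (h : IsP μ) (f : (V → Ω) → ℝ) : ∃ ω, Ex μ f ≤ f ω := by
  by_contra! hc
  have hpos : ∃ ω : V → Ω, 0 < ∏ v, μ v (ω v) := by
    by_contra! hc'
    have h1 := Ex_one h
    unfold Ex at h1
    have : ∑ ω : V → Ω, (∏ v, μ v (ω v)) * (1:ℝ) ≤ 0 :=
      Finset.sum_nonpos fun ω _ => by simpa using hc' ω
    linarith
  obtain ⟨ω₀, h0⟩ := hpos
  have : Ex μ f < Ex μ (fun _ => Ex μ f) := by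
    conv_lhs => unfold Ex
    conv_rhs => unfold Ex
    refine Finset.sum_lt_sum (fun ω _ => ?_) ⟨ω₀, Finset.mem_univ _, ?_⟩
    · exact mul_le_mul_of_nonneg_left (hc ω).le (Finset.prod_nonneg fun v _ => h.nonneg v _)
    · exact mul_lt_mul_of_pos_left (hc ω₀) h0
  rw [Ex_const h] at this
  exact lt_irrefl _ this

lemma Ex_mul (h : IsP μ) {f g : (V → Ω) → ℝ} {S S' : Finset V} (hf : Dep f S) (hg : Dep g S')
    (hd : Disjoint S S') : Ex μ (fun ω => f ω * g ω) = Ex μ f * Ex μ g := by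
  have e1 : Ex μ (fun ω => f ω * g ω) =
      ∑ p : (V → Ω) × (V → Ω), ((∏ v, μ v (p.1 v)) * (∏ v, μ v (p.2 v))) * (f p.1 * g p.1) := by
    rw [← mul_one (Ex μ _), ← Ex_one h]
    unfold Ex
    rw [Finset.sum_mul_sum, Fintype.sum_prod_type]
    refine Finset.sum_congr rfl fun _ _ => Finset.sum_congr rfl fun _ _ => by ring
  have e2 : Ex μ f * Ex μ g =
      ∑ p : (V → Ω) × (V → Ω), ((∏ v, μ v (p.1 v)) * (∏ v, μ v (p.2 v))) * (f p.1 * g p.2) := by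
    unfold Ex
    rw [Finset.sum_mul_sum, Fintype.sum_prod_type]
    refine Finset.sum_congr rfl fun _ _ => Finset.sum_congr rfl fun _ _ => by ring
  rw [e1, e2]
  symm
  let σ : (V → Ω) × (V → Ω) → (V → Ω) × (V → Ω) :=
    fun p => (fun v => if v ∈ S then p.1 v else p.2 v, fun v => if v ∈ S then p.2 v else p.1 v)
  have hσ : Function.Involutive σ := by
    intro p
    ext v <;> by_cases hv : v ∈ S <;> simp [σ, hv]
  refine Fintype.sum_equiv hσ.toPerm _ _ fun p => ?_
  have hw : (∏ v, μ v ((σ p).1 v)) * (∏ v, μ v ((σ p).2 v))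
      = (∏ v, μ v (p.1 v)) * (∏ v, μ v (p.2 v)) := by
    rw [← Finset.prod_mul_distrib, ← Finset.prod_mul_distrib]
    refine Finset.prod_congr rfl fun v _ => ?_
    by_cases hv : v ∈ S <;> simp [σ, hv, mul_comm]
  have h1 : f (σ p).1 = f p.1 := hf _ _ fun v hv => by simp [σ, hv]
  have h2 : g (σ p).1 = g p.2 := hg _ _ fun v hv => by
    have : v ∉ S := fun h' => Finset.disjoint_left.1 hd h' hv
    simp [σ, this]
  show _ = ((∏ v, μ v ((σ p).1 v)) * (∏ v, μ v ((σ p).2 v))) * (f (σ p).1 * g (σ p).1)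
  rw [hw, h1, h2]

lemma Dep.mono {f : (V → Ω) → ℝ} {S S' : Finset V} (hf : Dep f S) (h : S ⊆ S') : Dep f S' :=
  fun ω ω' hh => hf ω ω' fun v hv => hh v (h hv)

lemma Dep.mul {f g : (V → Ω) → ℝ} {S : Finset V} (hf : Dep f S) (hg : Dep g S) :
    Dep (fun ω => f ω * g ω) S := fun ω ω' hh => by
  simp only [hf ω ω' hh, hg ω ω' hh]

lemma Dep.one_sub {f : (V → Ω) → ℝ} {S : Finset V} (hf : Dep f S) :
    Dep (fun ω => 1 - f ω) S := fun ω ω' hh => by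
  simp only [hf ω ω' hh]

lemma Dep.prod {ι : Type*} {s : Finset ι} {f : ι → (V → Ω) → ℝ} {S : Finset V}
    (hf : ∀ i ∈ s, Dep (f i) S) : Dep (fun ω => ∏ i ∈ s, f i ω) S :=
  fun ω ω' hh => Finset.prod_congr rfl fun i hi => hf i hi ω ω' hh

lemma Dep.sum {ι : Type*} {s : Finset ι} {f : ι → (V → Ω) → ℝ} {S : Finset V}
    (hf : ∀ i ∈ s, Dep (f i) S) : Dep (fun ω => ∑ i ∈ s, f i ω) S :=
  fun ω ω' hh => Finset.sum_congr rfl fun i hi => hf i hi ω ω' hh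

lemma Ex_prod (h : IsP μ) {ι : Type*} [DecidableEq ι] (s : Finset ι) (f : ι → (V → Ω) → ℝ)
    (T : ι → Finset V) (hf : ∀ i ∈ s, Dep (f i) (T i))
    (hd : ∀ i ∈ s, ∀ j ∈ s, i ≠ j → Disjoint (T i) (T j)) :
    Ex μ (fun ω => ∏ i ∈ s, f i ω) = ∏ i ∈ s, Ex μ (f i) := by
  induction s using Finset.induction_on with
  | empty => simp [Ex_one h]
  | insert a s ha ih =>
    simp only [Finset.prod_insert ha]
    rw [← ih (fun i hi => hf i (Finset.mem_insert_of_mem hi))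
      (fun i hi j hj => hd i (Finset.mem_insert_of_mem hi) j (Finset.mem_insert_of_mem hj))]
    refine Ex_mul h (S := T a) (S' := s.biUnion T) (hf a (Finset.mem_insert_self _ _)) ?_ ?_
    · exact Dep.prod fun i hi => (hf i (Finset.mem_insert_of_mem hi)).mono
        (Finset.subset_biUnion_of_mem T hi)
    · rw [Finset.disjoint_biUnion_right]
      intro i hi
      exact hd a (Finset.mem_insert_self _ _) i (Finset.mem_insert_of_mem hi)
        (fun h' => ha (h' ▸ hi))

/-- Chebyshev-type bound for a sum of `[0,1]`-valued pairwise independent variables. -/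
lemma Ex_cheb (h : IsP μ) {ι : Type*} [DecidableEq ι] (s : Finset ι) (Z : ι → (V → Ω) → ℝ)
    (T : ι → Finset V) (hf : ∀ i ∈ s, Dep (Z i) (T i))
    (hd : ∀ i ∈ s, ∀ j ∈ s, i ≠ j → Disjoint (T i) (T j))
    (h0 : ∀ i ∈ s, ∀ ω, 0 ≤ Z i ω) (h1 : ∀ i ∈ s, ∀ ω, Z i ω ≤ 1)
    (m d : ℝ) (hd0 : 0 < d) (hm : ∑ i ∈ s, Ex μ (Z i) ≤ m) :
    Ex μ (fun ω => if m + d < ∑ i ∈ s, Z i ω then 1 else 0) ≤ m / d ^ 2 := by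
  set M := ∑ i ∈ s, Ex μ (Z i) with hM
  have hX : Ex μ (fun ω => ∑ i ∈ s, Z i ω) = M := Ex_sum s Z
  have hX2 : Ex μ (fun ω => (∑ i ∈ s, Z i ω) * (∑ i ∈ s, Z i ω)) ≤ M ^ 2 + M := by
    simp_rw [Finset.sum_mul_sum]
    rw [Ex_sum]
    simp_rw [Ex_sum]
    rw [pow_two]
    conv_rhs => rw [hM, Finset.sum_mul_sum, ← Finset.sum_add_distrib]
    refine Finset.sum_le_sum fun i hi => ?_
    rw [← Finset.add_sum_erase _ _ hi, ← Finset.add_sum_erase s (fun j => Ex μ (Z i) * Ex μ (Z j)) hi]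
    have a1 : Ex μ (fun ω => Z i ω * Z i ω) ≤ Ex μ (Z i) :=
      Ex_mono h fun ω => by nlinarith [h0 i hi ω, h1 i hi ω]
    have a2 : ∑ j ∈ s.erase i, Ex μ (fun ω => Z i ω * Z j ω)
        = ∑ j ∈ s.erase i, Ex μ (Z i) * Ex μ (Z j) := by
      refine Finset.sum_congr rfl fun j hj => ?_
      rw [Finset.mem_erase] at hj
      exact Ex_mul h (hf i hi) (hf j hj.2) (hd i hi j hj.2 (Ne.symm hj.1))
    have a3 : 0 ≤ Ex μ (Z i) * Ex μ (Z i) := mul_self_nonneg _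
    linarith
  have key : Ex μ (fun ω => (d ^ 2) * (if m + d < ∑ i ∈ s, Z i ω then 1 else 0)) ≤
      Ex μ (fun ω => (∑ i ∈ s, Z i ω) * (∑ i ∈ s, Z i ω) - ((2 * M) * (∑ i ∈ s, Z i ω) - M ^ 2)) := by
    refine Ex_mono h fun ω => ?_
    split_ifs with hc
    · nlinarith
    · nlinarith [sq_nonneg (∑ i ∈ s, Z i ω - M)]
  rw [Ex_cmul, Ex_sub, Ex_sub, Ex_cmul, Ex_const h, hX] at key
  rw [le_div_iff₀ (by positivity)]
  nlinarith

end Prob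
end BES
set_option linter.unusedSectionVars false
set_option linter.unusedVariables false
namespace BES
open Finset

lemma prod_one_sub_ge {ι : Type*} [DecidableEq ι] (s : Finset ι) (f : ι → ℝ)
    (h0 : ∀ i ∈ s, 0 ≤ f i) (h1 : ∀ i ∈ s, f i ≤ 1) :
    1 - ∑ i ∈ s, f i ≤ ∏ i ∈ s, (1 - f i) ∧ 0 ≤ ∏ i ∈ s, (1 - f i) ∧ ∏ i ∈ s, (1 - f i) ≤ 1 := by
  induction s using Finset.induction_on with
  | empty => simp
  | insert a s ha ih =>
    obtain ⟨i1, i2, i3⟩ := ih (fun i hi => h0 i (Finset.mem_insert_of_mem hi))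
      (fun i hi => h1 i (Finset.mem_insert_of_mem hi))
    have a0 := h0 a (Finset.mem_insert_self _ _)
    have a1 := h1 a (Finset.mem_insert_self _ _)
    rw [Finset.sum_insert ha, Finset.prod_insert ha]
    refine ⟨by nlinarith, mul_nonneg (by linarith) i2, by nlinarith⟩

/-- degree profile -/
noncomputable def DD (r : ℕ) (A y T : ℝ) (a : ℕ) : ℝ := A * r.choose a * y ^ (r - a) * T ^ a

lemma DD_sum (r b : ℕ) (hb : 1 ≤ b) (hbr : b ≤ r) (A y T p : ℝ) :
    ∑ a ∈ Finset.Icc 1 r, DD r A y T a * ((a.choose b : ℝ) * p ^ (a - b)) =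
      A * r.choose b * T ^ b * (y + p * T) ^ (r - b) := by
  have h1 : ∑ a ∈ Finset.Icc 1 r, DD r A y T a * ((a.choose b : ℝ) * p ^ (a - b)) =
      ∑ a ∈ Finset.Ico b (r + 1), DD r A y T a * ((a.choose b : ℝ) * p ^ (a - b)) := by
    symm
    apply Finset.sum_subset
    · intro a ha
      simp only [Finset.mem_Ico, Finset.mem_Icc] at ha ⊢
      omega
    · intro a ha hna
      simp only [Finset.mem_Ico, Finset.mem_Icc] at ha hna
      rw [Nat.choose_eq_zero_of_lt (by omega)]
      simp
  rw [h1, Finset.sum_Ico_eq_sum_range, add_comm y, add_pow, Finset.mul_sum]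
  rw [show r + 1 - b = r - b + 1 by omega]
  refine Finset.sum_congr rfl fun c hc => ?_
  rw [Finset.mem_range] at hc
  have hch : (r.choose (b + c) : ℝ) * ((b + c).choose b : ℝ) =
      (r.choose b : ℝ) * ((r - b).choose c : ℝ) := by
    have := Nat.choose_mul (n := r) (k := b + c) (s := b) (by omega)
    rw [show b + c - b = c by omega] at this
    exact_mod_cast this
  unfold DD
  rw [show b + c - b = c by omega, show r - (b + c) = r - b - c by omega, pow_add, mul_pow]
  linear_combination (A * y ^ (r - b - c) * T ^ b * T ^ c * p ^ c) * hch

lemma DD_block (r : ℕ) (A y T p : ℝ) :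
    ∑ a ∈ Finset.Icc 1 r, DD r A y T a * p ^ a = A * ((y + p * T) ^ r - y ^ r) := by
  rw [add_comm y, add_pow, Finset.sum_range_succ']
  rw [show Finset.Icc 1 r = Finset.Ico 1 (r + 1) by ext; simp, Finset.sum_Ico_eq_sum_range]
  simp only [pow_zero, Nat.sub_zero, Nat.choose_zero_right, Nat.cast_one, mul_one, one_mul,
    add_sub_cancel_right, Finset.mul_sum, Nat.add_sub_cancel]
  refine Finset.sum_congr rfl fun c hc => ?_
  unfold DD
  rw [add_comm 1 c, mul_pow]
  ring

section Step
variable {V : Type*} [Fintype V] [DecidableEq V]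

/-- No short cycles, in the form used. -/
structure Unc (G : Finset (Finset V)) : Prop where
  a : ∀ e ∈ G, ∀ g ∈ G, ∀ g' ∈ G, g ≠ e → g' ≠ e → ∀ w ∈ e, ∀ w' ∈ e, w ≠ w' → w ∈ g → w' ∈ g' →
    Disjoint g g'
  b : ∀ e ∈ G, ∀ f ∈ G, ∀ g ∈ G, ∀ g' ∈ G, e ≠ f → g ≠ e → g' ≠ f → ∀ u ∈ e, u ∈ f →
    ∀ w ∈ e, ∀ w' ∈ f, w ≠ u → w' ≠ u → w ∈ g → w' ∈ g' → Disjoint g g'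

lemma Unc.lin {G : Finset (Finset V)} (h : Unc G) {e g : Finset V} (he : e ∈ G) (hg : g ∈ G)
    (hne : g ≠ e) {w w' : V} (h1 : w ∈ e) (h2 : w' ∈ e) (h3 : w ∈ g) (h4 : w' ∈ g) : w = w' := by
  by_contra hc
  exact Finset.disjoint_left.1 (h.a e he g hg g hg hne hne w h1 w' h2 hc h3 h4) h3 h3

/-- indicator of chosen -/
noncomputable def ch (v : V) (ω : V → Fin 3) : ℝ := if ω v = 0 then 1 else 0
/-- indicator of live -/
noncomputable def lv (v : V) (ω : V → Fin 3) : ℝ := if ω v = 1 then 1 else 0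
/-- indicator that g blocks w -/
noncomputable def blk (g : Finset V) (w : V) (ω : V → Fin 3) : ℝ := ∏ x ∈ g.erase w, ch x ω
/-- indicator of being not blocked -/
noncomputable def nb (E : Finset (Finset V)) (w : V) (ω : V → Fin 3) : ℝ :=
  ∏ g ∈ E, (1 - blk g w ω)
/-- expected value of `nb` -/
noncomputable def bb (p : ℝ) (E : Finset (Finset V)) : ℝ := ∏ g ∈ E, (1 - p ^ (g.card - 1))
/-- star -/
def St (G : Finset (Finset V)) (w : V) : Finset (Finset V) := G.filter (fun g => w ∈ g)
/-- factor -/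
noncomputable def fw (G : Finset (Finset V)) (e : Finset V) (w : V) (ω : V → Fin 3) : ℝ :=
  lv w ω * nb ((St G w).erase e) w ω
/-- coordinates of the factor -/
def TT (G : Finset (Finset V)) (e : Finset V) (w : V) : Finset V :=
  insert w (((St G w).erase e).biUnion (fun g => g.erase w))
/-- contribution of an edge to the new degree -/
noncomputable def Z (G : Finset (Finset V)) (u : V) (b : ℕ) (e : Finset V) (ω : V → Fin 3) : ℝ :=
  ∑ R ∈ (e.erase u).powersetCard b, ∏ w ∈ e.erase u, (if w ∈ R then fw G e w ω else ch w ω)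
/-- measure -/
noncomputable def mu (p : ℝ) (lam : V → ℝ) (v : V) : Fin 3 → ℝ := ![p, lam v, 1 - p - lam v]

lemma mem_St {G : Finset (Finset V)} {w : V} {g : Finset V} : g ∈ St G w ↔ g ∈ G ∧ w ∈ g := by
  simp [St]

lemma ch01 (v : V) (ω : V → Fin 3) : 0 ≤ ch v ω ∧ ch v ω ≤ 1 := by
  unfold ch; split_ifs <;> norm_num
lemma lv01 (v : V) (ω : V → Fin 3) : 0 ≤ lv v ω ∧ lv v ω ≤ 1 := by
  unfold lv; split_ifs <;> norm_num
lemma lvch (v : V) (ω : V → Fin 3) : lv v ω + ch v ω ≤ 1 := by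
  unfold lv ch; split_ifs with h1 h2 <;> norm_num
  rw [h1] at h2; exact absurd h2 (by decide)
lemma blk01 (g : Finset V) (v : V) (ω : V → Fin 3) : 0 ≤ blk g v ω ∧ blk g v ω ≤ 1 :=
  ⟨Finset.prod_nonneg fun x _ => (ch01 x ω).1,
    Finset.prod_le_one (fun x _ => (ch01 x ω).1) fun x _ => (ch01 x ω).2⟩
lemma nb01 (E : Finset (Finset V)) (v : V) (ω : V → Fin 3) : 0 ≤ nb E v ω ∧ nb E v ω ≤ 1 :=
  (prod_one_sub_ge E (fun g => blk g v ω) (fun g _ => (blk01 g v ω).1)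
    (fun g _ => (blk01 g v ω).2)).2
lemma fw01 (G : Finset (Finset V)) (e : Finset V) (v : V) (ω : V → Fin 3) :
    0 ≤ fw G e v ω ∧ fw G e v ω ≤ lv v ω :=
  ⟨mul_nonneg (lv01 v ω).1 (nb01 _ v ω).1, mul_le_of_le_one_right (lv01 v ω).1 (nb01 _ v ω).2⟩

lemma Dep_ch (v : V) : Dep (ch v) {v} := fun ω ω' h => by
  unfold ch; rw [h v (Finset.mem_singleton_self v)]
lemma Dep_lv (v : V) : Dep (lv v) {v} := fun ω ω' h => by
  unfold lv; rw [h v (Finset.mem_singleton_self v)]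
lemma Dep_blk (g : Finset V) (v : V) : Dep (blk g v) (g.erase v) :=
  Dep.prod fun x hx => (Dep_ch x).mono (by simpa using hx)
lemma Dep_nb (E : Finset (Finset V)) (v : V) : Dep (nb E v) (E.biUnion (fun g => g.erase v)) :=
  Dep.prod fun g hg => ((Dep_blk g v).mono
    (Finset.subset_biUnion_of_mem (fun g : Finset V => g.erase v) hg)).one_sub
lemma Dep_fw (G : Finset (Finset V)) (e : Finset V) (w : V) : Dep (fw G e w) (TT G e w) :=
  Dep.mul ((Dep_lv w).mono (by simp [TT])) ((Dep_nb _ w).mono (Finset.subset_insert _ _))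
lemma Dep_Z (G : Finset (Finset V)) (u : V) (b : ℕ) (e : Finset V) :
    Dep (Z G u b e) ((e.erase u).biUnion (TT G e)) := by
  refine Dep.sum fun R hR => Dep.prod fun w hw => ?_
  have hs := Finset.subset_biUnion_of_mem (TT G e) hw
  split_ifs
  · exact (Dep_fw G e w).mono hs
  · exact (Dep_ch w).mono (Finset.Subset.trans (by simp [TT]) hs)

lemma Z01 (G : Finset (Finset V)) (u : V) (b : ℕ) (e : Finset V) (ω : V → Fin 3) :
    0 ≤ Z G u b e ω ∧ Z G u b e ω ≤ 1 := by
  have hn : ∀ R : Finset V, 0 ≤ ∏ w ∈ e.erase u, (if w ∈ R then fw G e w ω else ch w ω) := by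
    intro R
    refine Finset.prod_nonneg fun w _ => ?_
    split_ifs
    exacts [(fw01 G e w ω).1, (ch01 w ω).1]
  refine ⟨Finset.sum_nonneg fun R _ => hn R, ?_⟩
  calc Z G u b e ω ≤ ∑ R ∈ (e.erase u).powerset,
        ∏ w ∈ e.erase u, (if w ∈ R then fw G e w ω else ch w ω) :=
        Finset.sum_le_sum_of_subset_of_nonneg
          (fun R hR => Finset.mem_powerset.2 (Finset.mem_powersetCard.1 hR).1) fun R _ _ => hn R
    _ ≤ ∑ R ∈ (e.erase u).powerset, (∏ w ∈ R, lv w ω) * ∏ w ∈ (e.erase u) \ R, ch w ω := by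
        refine Finset.sum_le_sum fun R hR => ?_
        rw [Finset.mem_powerset] at hR
        rw [Finset.prod_ite, Finset.filter_mem_eq_inter, Finset.inter_eq_right.2 hR,
          ← Finset.sdiff_eq_filter]
        exact mul_le_mul_of_nonneg_right
          (Finset.prod_le_prod (fun w _ => (fw01 G e w ω).1) fun w _ => (fw01 G e w ω).2)
          (Finset.prod_nonneg fun w _ => (ch01 w ω).1)
    _ = ∏ w ∈ e.erase u, (lv w ω + ch w ω) := (Finset.prod_add _ _ _).symm
    _ ≤ 1 := Finset.prod_le_one (fun w _ => add_nonneg (lv01 w ω).1 (ch01 w ω).1)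
        fun w _ => lvch w ω

variable {p : ℝ} {lam : V → ℝ}

lemma Ex_ch (h : IsP (mu p lam)) (v : V) : Ex (mu p lam) (ch v) = p := by
  have := Ex_single h v (fun a => if a = 0 then (1:ℝ) else 0)
  exact this.trans (by simp [mu])
lemma Ex_lv (h : IsP (mu p lam)) (v : V) : Ex (mu p lam) (lv v) = lam v := by
  have := Ex_single h v (fun a => if a = 1 then (1:ℝ) else 0)
  exact this.trans (by simp [mu])
lemma Ex_blk (h : IsP (mu p lam)) {g : Finset V} {v : V} (hv : v ∈ g) :
    Ex (mu p lam) (blk g v) = p ^ (g.card - 1) := by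
  unfold blk
  rw [Ex_prod h (g.erase v) ch (fun v => {v}) (fun i _ => Dep_ch i)
    (fun i _ j _ hij => by simpa using hij)]
  simp [Ex_ch h, Finset.card_erase_of_mem hv]
lemma Ex_nb (h : IsP (mu p lam)) {G : Finset (Finset V)} (hG : Unc G) {v : V}
    {E : Finset (Finset V)} (hE : E ⊆ St G v) :
    Ex (mu p lam) (nb E v) = bb p E := by
  unfold nb bb
  rw [Ex_prod h E (fun g ω => 1 - blk g v ω) (fun g => g.erase v) (fun g _ => (Dep_blk g v).one_sub)]
  · refine Finset.prod_congr rfl fun g hg => ?_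
    rw [Ex_sub, Ex_const h, ← Ex_blk h (mem_St.1 (hE hg)).2]
  · intro g hg g' hg' hne
    have h1 := mem_St.1 (hE hg)
    have h2 := mem_St.1 (hE hg')
    rw [Finset.disjoint_left]
    intro x hx hx'
    rw [Finset.mem_erase] at hx hx'
    exact hx.1 (hG.lin h1.1 h2.1 hne.symm hx.2 h1.2 hx'.2 h2.2)
lemma Ex_fnb (h : IsP (mu p lam)) {G : Finset (Finset V)} (hG : Unc G) {v : V}
    {E : Finset (Finset V)} (hE : E ⊆ St G v) (f : (V → Fin 3) → ℝ) (hf : Dep f {v}) :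
    Ex (mu p lam) (fun ω => f ω * nb E v ω) = Ex (mu p lam) f * bb p E := by
  rw [Ex_mul h hf (Dep_nb E v), Ex_nb h hG hE]
  simp

lemma Ex_Z (h : IsP (mu p lam)) {G : Finset (Finset V)} (hG : Unc G) (rho : ℝ)
    (hp0 : 0 ≤ p) (hp1 : p < 1) (hrho : 0 ≤ rho)
    (hlam : ∀ v, lam v * bb p (St G v) = rho)
    (h2 : ∀ e ∈ G, 2 ≤ e.card) {u : V} {b : ℕ} {e : Finset V} (he : e ∈ G) (hu : u ∈ e) :
    Ex (mu p lam) (Z G u b e) ≤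
      ((e.card - 1).choose b : ℝ) * p ^ (e.card - 1 - b) * (rho / (1 - p)) ^ b := by
  have hF : ∀ w ∈ e.erase u, Ex (mu p lam) (fw G e w) ≤ rho / (1 - p) := by
    intro w hw
    have hwe := Finset.mem_of_mem_erase hw
    have h1 : Ex (mu p lam) (fw G e w) = lam w * bb p ((St G w).erase e) := by
      have := Ex_fnb h hG (v := w) (E := (St G w).erase e) (Finset.erase_subset _ _) (lv w) (Dep_lv w)
      rw [Ex_lv h] at this
      exact this
    have h3 : bb p (St G w) = (1 - p ^ (e.card - 1)) * bb p ((St G w).erase e) := by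
      unfold bb
      rw [Finset.mul_prod_erase _ (fun g : Finset V => 1 - p ^ (g.card - 1)) (mem_St.2 ⟨he, hwe⟩)]
    have h4 := hlam w
    rw [h3] at h4
    have h5 : p ^ (e.card - 1) ≤ p := by
      have := h2 e he
      calc p ^ (e.card - 1) ≤ p ^ 1 := pow_le_pow_of_le_one hp0 hp1.le (by omega)
        _ = p := pow_one p
    rw [le_div_iff₀ (by linarith), h1]
    have h6 : 0 ≤ lam w * bb p ((St G w).erase e) := by
      rw [← h1]
      exact Ex_nonneg h fun ω => (fw01 G e w ω).1
    nlinarith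
  have hF0 : ∀ w, 0 ≤ Ex (mu p lam) (fw G e w) := fun w => Ex_nonneg h fun ω => (fw01 G e w ω).1
  have hR : ∀ R ∈ (e.erase u).powersetCard b,
      Ex (mu p lam) (fun ω => ∏ w ∈ e.erase u, (if w ∈ R then fw G e w ω else ch w ω)) ≤
        p ^ (e.card - 1 - b) * (rho / (1 - p)) ^ b := by
    intro R hR
    rw [Finset.mem_powersetCard] at hR
    have hdis : ∀ w ∈ e.erase u, ∀ w' ∈ e.erase u, w ≠ w' → Disjoint (TT G e w) (TT G e w') := by
      intro w hw w' hw' hne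
      have hwe := Finset.mem_of_mem_erase hw
      have hwe' := Finset.mem_of_mem_erase hw'
      rw [Finset.disjoint_left]
      intro x hx hx'
      simp only [TT, Finset.mem_insert, Finset.mem_biUnion, Finset.mem_erase, mem_St] at hx hx'
      rcases hx with rfl | ⟨g, ⟨hge, hgG, hwg⟩, hxw, hxg⟩
      · rcases hx' with rfl | ⟨g', ⟨hge', hgG', hwg'⟩, hxw', hxg'⟩
        · exact hne rfl
        · exact hne (hG.lin he hgG' hge' hwe hwe' hxg' hwg')
      · rcases hx' with rfl | ⟨g', ⟨hge', hgG', hwg'⟩, hxw', hxg'⟩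
        · exact hne (hG.lin he hgG hge hwe hwe' hwg hxg)
        · exact Finset.disjoint_left.1
            (hG.a e he g hgG g' hgG' hge hge' w hwe w' hwe' hne hwg hwg') hxg hxg'
    have := Ex_prod h (e.erase u) (fun w ω => if w ∈ R then fw G e w ω else ch w ω) (TT G e)
      (fun w hw => by
        by_cases hwR : w ∈ R
        · simp only [hwR, if_true]; exact Dep_fw G e w
        · simp only [hwR, if_false]; exact (Dep_ch w).mono (by simp [TT])) hdis
    rw [this]
    have e1 : ∀ w ∈ e.erase u, Ex (mu p lam) (fun ω => if w ∈ R then fw G e w ω else ch w ω) =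
        if w ∈ R then Ex (mu p lam) (fw G e w) else p := by
      intro w _
      by_cases hwR : w ∈ R
      · simp only [hwR, if_true]
      · simp only [hwR, if_false]; exact Ex_ch h w
    rw [Finset.prod_congr rfl e1, Finset.prod_ite, Finset.filter_mem_eq_inter,
      Finset.inter_eq_right.2 hR.1, ← Finset.sdiff_eq_filter, Finset.prod_const,
      Finset.card_sdiff_of_subset hR.1, Finset.card_erase_of_mem hu, hR.2, mul_comm]
    refine mul_le_mul_of_nonneg_left ?_ (pow_nonneg hp0 _)
    calc ∏ w ∈ R, Ex (mu p lam) (fw G e w) ≤ ∏ w ∈ R, (rho / (1 - p)) :=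
          Finset.prod_le_prod (fun w _ => hF0 w) fun w hw => hF w (hR.1 hw)
      _ = _ := by rw [Finset.prod_const, hR.2]
  unfold Z
  rw [Ex_sum]
  refine (Finset.sum_le_sum hR).trans ?_
  rw [Finset.sum_const, Finset.card_powersetCard, Finset.card_erase_of_mem hu, nsmul_eq_mul, mul_assoc]

lemma Z_disj {G : Finset (Finset V)} (hG : Unc G) {u : V} {e f : Finset V} (he : e ∈ St G u)
    (hf : f ∈ St G u) (hef : e ≠ f) :
    Disjoint ((e.erase u).biUnion (TT G e)) ((f.erase u).biUnion (TT G f)) := by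
  rw [mem_St] at he hf
  rw [Finset.disjoint_left]
  intro x hx hx'
  simp only [TT, Finset.mem_insert, Finset.mem_biUnion, Finset.mem_erase, mem_St] at hx hx'
  obtain ⟨w, ⟨hwu, hwe⟩, hx⟩ := hx
  obtain ⟨w', ⟨hwu', hwf⟩, hx'⟩ := hx'
  rcases hx with rfl | ⟨g, ⟨hge, hgG, hwg⟩, hxw, hxg⟩
  · rcases hx' with rfl | ⟨g', ⟨hge', hgG', hwg'⟩, hxw', hxg'⟩
    · exact hwu (hG.lin he.1 hf.1 hef.symm hwe he.2 hwf hf.2)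
    · exact Finset.disjoint_left.1 (hG.a f hf.1 e he.1 g' hgG' hef hge' u hf.2 w' hwf hwu'.symm
        he.2 hwg') hwe hxg'
  · rcases hx' with rfl | ⟨g', ⟨hge', hgG', hwg'⟩, hxw', hxg'⟩
    · exact Finset.disjoint_left.1 (hG.a e he.1 g hgG f hf.1 hge hef.symm w hwe u he.2 hwu
        hwg hf.2) hxg hwf
    · exact Finset.disjoint_left.1 (hG.b e he.1 f hf.1 g hgG g' hgG' hef hge hge' u he.2 hf.2
        w hwe w' hwf hwu hwu' hwg hwg') hxg hxg'

end Step
end BES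
set_option linter.unusedSectionVars false
set_option linter.unusedVariables false
namespace BES
open Finset

section Step2
variable {V : Type*} [Fintype V] [DecidableEq V]

/-- invariants of the nibble -/
structure Good (G : Finset (Finset V)) (F : Finset V) (r : ℕ) (A y T : ℝ) : Prop where
  sub : ∀ e ∈ G, e ⊆ F
  two : ∀ e ∈ G, 2 ≤ e.card
  top : ∀ e ∈ G, e.card ≤ r + 1
  unc : Unc G
  deg : ∀ u ∈ F, ∀ a ∈ Finset.Icc 1 r,
    (((St G u).filter (fun e => e.card = a + 1)).card : ℝ) ≤ DD r A y T a

lemma Good.sum {G : Finset (Finset V)} {F : Finset V} {r : ℕ} {A y T : ℝ} (hg : Good G F r A y T)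
    (h : ℕ → ℝ) (h0 : ∀ a, 0 ≤ h a) {u : V} (hu : u ∈ F) :
    ∑ e ∈ St G u, h (e.card - 1) ≤ ∑ a ∈ Finset.Icc 1 r, DD r A y T a * h a := by
  have hmap : ∀ e ∈ St G u, e.card - 1 ∈ Finset.Icc 1 r := by
    intro e he
    have h1 := hg.two e (mem_St.1 he).1
    have h2 := hg.top e (mem_St.1 he).1
    rw [Finset.mem_Icc]; omega
  rw [← Finset.sum_fiberwise_of_maps_to hmap]
  refine Finset.sum_le_sum fun a ha => ?_
  have : ∑ e ∈ St G u with e.card - 1 = a, h (e.card - 1) =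
      (((St G u).filter (fun e => e.card = a + 1)).card : ℝ) * h a := by
    rw [Finset.sum_congr rfl (g := fun _ => h a)]
    · rw [Finset.sum_const, nsmul_eq_mul]
      congr 3
      refine Finset.filter_congr fun e he => ?_
      have := hg.two e (mem_St.1 he).1
      omega
    · intro e he
      rw [(Finset.mem_filter.1 he).2]
  rw [this]
  exact mul_le_mul_of_nonneg_right (hg.deg u hu a ha) (h0 a)

lemma Unc.image {G : Finset (Finset V)} (hG : Unc G) (P : Finset V → Prop) [DecidablePred P]
    (F : Finset V) : Unc ((G.filter P).image (fun e => e ∩ F)) := by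
  constructor
  · intro e he g hg g' hg' h1 h2 w hw w' hw' hne hwg hwg'
    simp only [Finset.mem_image, Finset.mem_filter] at he hg hg'
    obtain ⟨e, he, rfl⟩ := he
    obtain ⟨g, hg, rfl⟩ := hg
    obtain ⟨g', hg', rfl⟩ := hg'
    rw [Finset.mem_inter] at *
    exact (hG.a e he.1 g hg.1 g' hg'.1 (by rintro rfl; exact h1 rfl) (by rintro rfl; exact h2 rfl)
      w hw.1 w' hw'.1 hne hwg.1 hwg'.1).mono Finset.inter_subset_left Finset.inter_subset_left
  · intro e he f hf g hg g' hg' h0 h1 h2 u hu hu' w hw w' hw' hne hne' hwg hwg'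
    simp only [Finset.mem_image, Finset.mem_filter] at he hf hg hg'
    obtain ⟨e, he, rfl⟩ := he
    obtain ⟨f, hf, rfl⟩ := hf
    obtain ⟨g, hg, rfl⟩ := hg
    obtain ⟨g', hg', rfl⟩ := hg'
    rw [Finset.mem_inter] at *
    exact (hG.b e he.1 f hf.1 g hg.1 g' hg'.1 (by rintro rfl; exact h0 rfl)
      (by rintro rfl; exact h1 rfl) (by rintro rfl; exact h2 rfl)
      u hu.1 hu'.1 w hw.1 w' hw'.1 hne hne' hwg.1 hwg'.1).mono
        Finset.inter_subset_left Finset.inter_subset_left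

/-- the deterministic part of the step -/
lemma det_step {r : ℕ} {A A' y y' T T' : ℝ} {G : Finset (Finset V)} {F : Finset V}
    (hg : Good G F r A y T) (ω : V → Fin 3) :
    ∃ C F' : Finset V, ∃ G' : Finset (Finset V), C ⊆ F ∧ F' ⊆ F ∧ Disjoint C F' ∧
      Good G' F' r A' y' T' ∧
      (∀ J ⊆ F', (∀ e ∈ G', ¬ e ⊆ J) → ∀ e ∈ G, ¬ e ⊆ C ∪ J) ∧
      (∑ v ∈ F, ch v ω * nb (St G v) v ω ≤ C.card) ∧
      (∑ v ∈ F, (lv v ω * nb (St G v) v ω -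
        ∑ b ∈ Finset.Icc 1 r, if DD r A' y' T' b < ∑ e ∈ St G v, Z G v b e ω then (1:ℝ) else 0)
          ≤ F'.card) := by
  classical
  let unb : V → Prop := fun v => ∀ g ∈ G, v ∈ g → ¬ ∀ x ∈ g.erase v, ω x = 0
  have blk1 : ∀ g v, (∀ x ∈ g.erase v, ω x = 0) → blk g v ω = 1 := fun g v h =>
    Finset.prod_eq_one fun x hx => by simp [ch, h x hx]
  have blk0 : ∀ g v, (¬ ∀ x ∈ g.erase v, ω x = 0) → blk g v ω = 0 := fun g v h => by
    push Not at h
    obtain ⟨x, hx, hx'⟩ := h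
    exact Finset.prod_eq_zero hx (by simp [ch, hx'])
  have nb0 : ∀ v, ¬ unb v → nb (St G v) v ω = 0 := fun v h => by
    simp only [unb] at h
    push Not at h
    obtain ⟨g, hgG, hvg, hx⟩ := h
    exact Finset.prod_eq_zero (mem_St.2 ⟨hgG, hvg⟩) (by rw [blk1 g v hx, sub_self])
  have nb1 : ∀ v, unb v → ∀ E ⊆ St G v, nb E v ω = 1 := fun v h E hE =>
    Finset.prod_eq_one fun g hgE => by
      have := mem_St.1 (hE hgE)
      rw [blk0 g v (h g this.1 this.2), sub_zero]
  let good : V → Prop := fun v => ∀ b ∈ Finset.Icc 1 r, ∑ e ∈ St G v, Z G v b e ω ≤ DD r A' y' T' b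
  let C : Finset V := F.filter fun v => ω v = 0 ∧ unb v
  let F' : Finset V := F.filter fun v => ω v = 1 ∧ unb v ∧ good v
  let G' : Finset (Finset V) := (G.filter fun e => e ⊆ C ∪ F').image fun e => e ∩ F'
  have hCmem : ∀ {v}, v ∈ C → v ∈ F ∧ ω v = 0 ∧ unb v := fun hv => by simpa [C] using hv
  have hFmem : ∀ {v}, v ∈ F' → v ∈ F ∧ ω v = 1 ∧ unb v ∧ good v := fun hv => by simpa [F'] using hv
  have hCF : Disjoint C F' := by
    rw [Finset.disjoint_left]
    intro v h1 h2
    have := (hCmem h1).2.1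
    rw [(hFmem h2).2.1] at this
    exact absurd this (by decide)
  refine ⟨C, F', G', Finset.filter_subset _ _, Finset.filter_subset _ _, hCF, ?_, ?_, ?_, ?_⟩
  · refine ⟨?_, ?_, ?_, hg.unc.image _ _, ?_⟩
    · intro e he
      simp only [G', Finset.mem_image] at he
      obtain ⟨e, _, rfl⟩ := he
      exact Finset.inter_subset_right
    · intro e he
      simp only [G', Finset.mem_image, Finset.mem_filter] at he
      obtain ⟨e, ⟨heG, heC⟩, rfl⟩ := he
      by_contra hlt
      have h2 := hg.two e heG
      -- pick a vertex v of e with e.erase v ⊆ C and v unblocked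
      have : ∃ v ∈ e, (e ∩ F') ⊆ {v} := by
        rcases Finset.eq_empty_or_nonempty (e ∩ F') with h0 | ⟨v, hv⟩
        · have : e.Nonempty := Finset.card_pos.1 (by omega)
          obtain ⟨v, hv⟩ := this
          exact ⟨v, hv, by rw [h0]; simp⟩
        · refine ⟨v, (Finset.mem_inter.1 hv).1, ?_⟩
          intro x hx
          rw [Finset.mem_singleton]
          exact Finset.card_le_one.1 (by omega) x hx v hv
      obtain ⟨v, hve, hv⟩ := this
      have hu : unb v := by
        rcases Finset.mem_union.1 (heC hve) with h | h
        · exact (hCmem h).2.2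
        · exact (hFmem h).2.2.1
      refine hu e heG hve fun x hx => ?_
      rw [Finset.mem_erase] at hx
      rcases Finset.mem_union.1 (heC hx.2) with h | h
      · exact (hCmem h).2.1
      · exact absurd (Finset.mem_singleton.1 (hv (Finset.mem_inter.2 ⟨hx.2, h⟩))) hx.1
    · intro e he
      simp only [G', Finset.mem_image, Finset.mem_filter] at he
      obtain ⟨e, ⟨heG, heC⟩, rfl⟩ := he
      exact (Finset.card_le_card Finset.inter_subset_left).trans (hg.top e heG)
    · intro u hu b hb
      have huF := hFmem hu
      let Q := (St G u).filter fun e => e ⊆ C ∪ F' ∧ (e ∩ F').card = b + 1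
      have h1 : (St G' u).filter (fun e => e.card = b + 1) ⊆ Q.image fun e => e ∩ F' := by
        intro e he
        rw [Finset.mem_filter, mem_St] at he
        obtain ⟨⟨heG, hue⟩, hc⟩ := he
        simp only [G', Finset.mem_image, Finset.mem_filter] at heG
        obtain ⟨e, ⟨heG, heC⟩, rfl⟩ := heG
        rw [Finset.mem_image]
        exact ⟨e, Finset.mem_filter.2 ⟨mem_St.2 ⟨heG, (Finset.mem_inter.1 hue).1⟩, heC, hc⟩, rfl⟩
      have h2 : ((St G' u).filter (fun e => e.card = b + 1)).card ≤ Q.card :=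
        (Finset.card_le_card h1).trans Finset.card_image_le
      have h3 : (Q.card : ℝ) ≤ ∑ e ∈ Q, Z G u b e ω := by
        rw [Finset.card_eq_sum_ones, Nat.cast_sum]
        refine Finset.sum_le_sum fun e he => ?_
        rw [Finset.mem_filter, mem_St] at he
        obtain ⟨⟨heG, hue⟩, heC, hc⟩ := he
        have hRm : (e ∩ F').erase u ∈ (e.erase u).powersetCard b := by
          rw [Finset.mem_powersetCard]
          refine ⟨Finset.erase_subset_erase _ Finset.inter_subset_left, ?_⟩
          rw [Finset.card_erase_of_mem (Finset.mem_inter.2 ⟨hue, hu⟩), hc]; rfl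
        have hnn : ∀ R ∈ (e.erase u).powersetCard b,
            0 ≤ ∏ w ∈ e.erase u, (if w ∈ R then fw G e w ω else ch w ω) := by
          intro R _
          refine Finset.prod_nonneg fun w _ => ?_
          split_ifs
          exacts [(fw01 G e w ω).1, (ch01 w ω).1]
        refine le_trans ?_ (Finset.single_le_sum hnn hRm)
        rw [Finset.prod_eq_one]
        · simp
        · intro w hw
          rw [Finset.mem_erase] at hw
          by_cases hwF : w ∈ F'
          · rw [if_pos (Finset.mem_erase.2 ⟨hw.1, Finset.mem_inter.2 ⟨hw.2, hwF⟩⟩)]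
            have h := hFmem hwF
            rw [fw, nb1 w h.2.2.1 _ (Finset.erase_subset _ _), lv, if_pos h.2.1, mul_one]
          · rw [if_neg (fun h => hwF (Finset.mem_inter.1 (Finset.mem_of_mem_erase h)).2)]
            rcases Finset.mem_union.1 (heC hw.2) with h | h
            · rw [ch, if_pos (hCmem h).2.1]
            · exact absurd h hwF
      have h4 : ∑ e ∈ Q, Z G u b e ω ≤ ∑ e ∈ St G u, Z G u b e ω :=
        Finset.sum_le_sum_of_subset_of_nonneg (Finset.filter_subset _ _)
          fun e _ _ => (Z01 G u b e ω).1
      have h5 := huF.2.2.2 b hb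
      have h6 : (((St G' u).filter (fun e => e.card = b + 1)).card : ℝ) ≤ Q.card := by
        exact_mod_cast h2
      linarith
  · intro J hJ hind e heG heJ
    have h1 : e ⊆ C ∪ F' := heJ.trans (Finset.union_subset_union_right hJ)
    refine hind (e ∩ F') (Finset.mem_image.2 ⟨e, Finset.mem_filter.2 ⟨heG, h1⟩, rfl⟩) ?_
    intro x hx
    rw [Finset.mem_inter] at hx
    rcases Finset.mem_union.1 (heJ hx.1) with h | h
    · exact absurd hx.2 (Finset.disjoint_left.1 hCF h)
    · exact h
  · rw [Finset.card_filter, Nat.cast_sum]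
    refine Finset.sum_le_sum fun v hv => ?_
    have n01 := nb01 (St G v) v ω
    have c01 := ch01 v ω
    by_cases h : ω v = 0 ∧ unb v
    · rw [if_pos h]; push_cast; exact mul_le_one₀ c01.2 n01.1 n01.2
    · rw [if_neg h]; push_cast
      by_cases h' : unb v
      · have : ω v ≠ 0 := fun h'' => h ⟨h'', h'⟩
        simp [ch, this]
      · rw [nb0 v h', mul_zero]
  · rw [Finset.card_filter, Nat.cast_sum]
    refine Finset.sum_le_sum fun v hv => ?_
    have n01 := nb01 (St G v) v ω
    have l01 := lv01 v ω
    have hnn : ∀ b ∈ Finset.Icc 1 r,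
      (0:ℝ) ≤ if DD r A' y' T' b < ∑ e ∈ St G v, Z G v b e ω then (1:ℝ) else 0 := by
      intro b _; split_ifs <;> norm_num
    have hs := Finset.sum_nonneg hnn
    have hle : lv v ω * nb (St G v) v ω ≤ 1 := mul_le_one₀ l01.2 n01.1 n01.2
    by_cases h : ω v = 1 ∧ unb v ∧ good v
    · rw [if_pos h]; push_cast; linarith
    · rw [if_neg h]; push_cast
      by_cases h' : unb v
      · by_cases h1 : ω v = 1
        · have hb : ¬ good v := fun hb => h ⟨h1, h', hb⟩
          simp only [good] at hb
          push Not at hb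
          obtain ⟨b, hb, hlt⟩ := hb
          have := Finset.single_le_sum hnn hb
          rw [if_pos hlt] at this
          linarith
        · have : lv v ω = 0 := by simp [lv, h1]
          rw [this]; linarith
      · rw [nb0 v h']; linarith

theorem step {r : ℕ} {A y T : ℝ} {G : Finset (Finset V)} {F : Finset V}
    (hg : Good G F r A y T) {p η β : ℝ} (hA : 1 ≤ A) (hy : 1 ≤ y) (hT : 2 ≤ T) (hp0 : 0 ≤ p)
    (hp : p ≤ 1 / 8) (hblock : A * ((y + p * T) ^ r - y ^ r) ≤ 1 / 8) (hη0 : 0 < η) (hη1 : η ≤ 1)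
    (hη : (1 / (1 - p)) ^ r ≤ 1 + η / 2) (hβ : 0 ≤ β) :
    ∃ C F' : Finset V, ∃ G' : Finset (Finset V), C ⊆ F ∧ F' ⊆ F ∧ Disjoint C F' ∧
      Good G' F' r (A * (1 + η)) (y + p * T) (3 / 4 * T) ∧
      (∀ J ⊆ F', (∀ e ∈ G', ¬ e ⊆ J) → ∀ e ∈ G, ¬ e ⊆ C ∪ J) ∧
      (7 / 8 * p + β * (3 / 4 - 8 * r / (η ^ 2 * T))) * F.card ≤ C.card + β * F'.card := by
  have hp01 : ∀ g ∈ G, 0 ≤ p ^ (g.card - 1) ∧ p ^ (g.card - 1) ≤ 1 := fun g _ =>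
    ⟨pow_nonneg hp0 _, pow_le_one₀ hp0 (by linarith)⟩
  have hbb : ∀ v, 7 / 8 ≤ bb p (St G v) := by
    intro v
    by_cases hv : v ∈ F
    · have h1 := (prod_one_sub_ge (St G v) (fun g => p ^ (g.card - 1))
        (fun g hgg => (hp01 g (mem_St.1 hgg).1).1) (fun g hgg => (hp01 g (mem_St.1 hgg).1).2)).1
      have h2 := hg.sum (fun a => p ^ a) (fun a => pow_nonneg hp0 _) hv
      rw [DD_block] at h2
      unfold bb
      linarith
    · have : St G v = ∅ := by
        rw [Finset.eq_empty_iff_forall_notMem]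
        intro g hgg
        rw [mem_St] at hgg
        exact hv (hg.sub g hgg.1 hgg.2)
      rw [this]; simp [bb]; norm_num
  let lam : V → ℝ := fun v => (3 / 4) / bb p (St G v)
  have hlam : ∀ v, lam v * bb p (St G v) = 3 / 4 := fun v => by
    have := hbb v
    exact div_mul_cancel₀ _ (by linarith)
  have hlam0 : ∀ v, 0 ≤ lam v := fun v => div_nonneg (by norm_num) (by linarith [hbb v])
  have hlam1 : ∀ v, lam v ≤ 6 / 7 := fun v => by
    nlinarith [hbb v, hlam v, hlam0 v]
  have hP : IsP (mu p lam) := by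
    constructor
    · intro v a
      fin_cases a
      · simpa [mu] using hp0
      · simpa [mu] using hlam0 v
      · simp [mu]; linarith [hlam1 v]
    · intro v
      simp [mu, Fin.sum_univ_three]
  set A' := A * (1 + η) with hA'
  set y' := y + p * T with hy'
  set T' := 3 / 4 * T with hT'
  have hy1 : 1 ≤ y' := by rw [hy']; nlinarith
  have hT1 : 1 ≤ T' := by rw [hT']; linarith
  have hbad : ∀ v ∈ F, ∀ b ∈ Finset.Icc 1 r,
      Ex (mu p lam) (fun ω => if DD r A' y' T' b < ∑ e ∈ St G v, Z G v b e ω then (1:ℝ) else 0)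
        ≤ 8 / (η ^ 2 * T) := by
    intro v hv b hb
    rw [Finset.mem_Icc] at hb
    set D := DD r A y' T' b with hD
    have hDT : 3 / 4 * T ≤ D := by
      rw [hD]; unfold DD
      have c1 : (1:ℝ) ≤ r.choose b := by exact_mod_cast Nat.choose_pos hb.2
      have c2 : (1:ℝ) ≤ y' ^ (r - b) := one_le_pow₀ hy1
      have c3 : T' ≤ T' ^ b := by
        calc T' = T' ^ 1 := (pow_one _).symm
          _ ≤ T' ^ b := pow_le_pow_right₀ hT1 hb.1
      have c4 : (1:ℝ) ≤ A * r.choose b * y' ^ (r - b) := by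
        have := mul_le_mul hA c1 zero_le_one (by linarith)
        have := mul_le_mul this c2 zero_le_one (by positivity)
        linarith
      nlinarith
    have hDpos : 0 < D := by linarith
    have hsplit : DD r A' y' T' b = (1 + η / 2) * D + (η / 2) * D := by
      rw [hD, hA']; unfold DD; ring
    have hmean : ∑ e ∈ St G v, Ex (mu p lam) (Z G v b e) ≤ (1 + η / 2) * D := by
      have h1 : ∀ e ∈ St G v, Ex (mu p lam) (Z G v b e) ≤
          ((e.card - 1).choose b : ℝ) * p ^ (e.card - 1 - b) * ((3 / 4) / (1 - p)) ^ b := fun e he =>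
        Ex_Z hP hg.unc (3 / 4) hp0 (by linarith) (by norm_num) hlam hg.two (mem_St.1 he).1
          (mem_St.1 he).2
      refine (Finset.sum_le_sum h1).trans ?_
      rw [← Finset.sum_mul]
      have h2 := hg.sum (fun a => (a.choose b : ℝ) * p ^ (a - b))
        (fun a => mul_nonneg (Nat.cast_nonneg _) (pow_nonneg hp0 _)) hv
      rw [DD_sum r b hb.1 hb.2] at h2
      have h3 : (0:ℝ) ≤ ((3 / 4) / (1 - p)) ^ b := pow_nonneg (div_nonneg (by norm_num) (by linarith)) _
      refine (mul_le_mul_of_nonneg_right h2 h3).trans ?_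
      have h4 : A * (r.choose b) * T ^ b * (y + p * T) ^ (r - b) * ((3 / 4) / (1 - p)) ^ b
          = (1 / (1 - p)) ^ b * D := by
        rw [hD]; unfold DD; rw [hT', mul_pow, div_eq_mul_one_div (3 / 4 : ℝ) (1 - p), mul_pow]; ring
      rw [h4]
      refine mul_le_mul_of_nonneg_right (le_trans ?_ hη) hDpos.le
      refine pow_le_pow_right₀ ?_ hb.2
      rw [le_div_iff₀ (by linarith)]; linarith
    have := Ex_cheb hP (St G v) (Z G v b) (fun e => (e.erase v).biUnion (TT G e))
      (fun e _ => Dep_Z G v b e) (fun e he f hf hef => Z_disj hg.unc he hf hef)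
      (fun e _ ω => (Z01 G v b e ω).1) (fun e _ ω => (Z01 G v b e ω).2)
      ((1 + η / 2) * D) ((η / 2) * D) (by positivity) hmean
    rw [← hsplit] at this
    refine this.trans ?_
    rw [div_le_div_iff₀ (by positivity) (by positivity)]
    have e1 : (1 + η / 2) * D * (η ^ 2 * T) = ((1 + η / 2) * T) * (D * η ^ 2) := by ring
    have e2 : 8 * (η / 2 * D) ^ 2 = (2 * D) * (D * η ^ 2) := by ring
    rw [e1, e2]
    refine mul_le_mul_of_nonneg_right ?_ (by positivity)
    nlinarith
  have hEx : (7 / 8 * p + β * (3 / 4 - 8 * r / (η ^ 2 * T))) * F.card ≤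
      Ex (mu p lam) (fun ω => (∑ v ∈ F, ch v ω * nb (St G v) v ω) +
        β * (∑ v ∈ F, (lv v ω * nb (St G v) v ω -
        ∑ b ∈ Finset.Icc 1 r, if DD r A' y' T' b < ∑ e ∈ St G v, Z G v b e ω then (1:ℝ) else 0))) := by
    rw [Ex_add, Ex_cmul, Ex_sum, Ex_sum]
    have h1 : ∀ v ∈ F, 7 / 8 * p ≤ Ex (mu p lam) (fun ω => ch v ω * nb (St G v) v ω) := by
      intro v _
      rw [Ex_fnb hP hg.unc (Finset.Subset.refl _) _ (Dep_ch v), Ex_ch hP]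
      nlinarith [hbb v]
    have h2 : ∀ v ∈ F, 3 / 4 - 8 * r / (η ^ 2 * T) ≤
        Ex (mu p lam) (fun ω => lv v ω * nb (St G v) v ω -
        ∑ b ∈ Finset.Icc 1 r, if DD r A' y' T' b < ∑ e ∈ St G v, Z G v b e ω then (1:ℝ) else 0) := by
      intro v hv
      rw [Ex_sub, Ex_sum, Ex_fnb hP hg.unc (Finset.Subset.refl _) _ (Dep_lv v), Ex_lv hP, hlam]
      have := Finset.sum_le_sum (hbad v hv)
      rw [Finset.sum_const, Nat.card_Icc, nsmul_eq_mul, Nat.add_sub_cancel] at this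
      have e : (r:ℝ) * (8 / (η ^ 2 * T)) = 8 * r / (η ^ 2 * T) := by ring
      linarith
    have h3 := Finset.sum_le_sum h1
    have h4 := mul_le_mul_of_nonneg_left (Finset.sum_le_sum h2) hβ
    rw [Finset.sum_const, nsmul_eq_mul] at h3 h4
    linarith
  obtain ⟨ω, hω⟩ := Ex_exists hP (fun ω => (∑ v ∈ F, ch v ω * nb (St G v) v ω) +
        β * (∑ v ∈ F, (lv v ω * nb (St G v) v ω -
        ∑ b ∈ Finset.Icc 1 r, if DD r A' y' T' b < ∑ e ∈ St G v, Z G v b e ω then (1:ℝ) else 0)))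
  obtain ⟨C, F', G', h1, h2, h3, h4, h5, h6, h7⟩ := det_step (A' := A') (y' := y') (T' := T') hg ω
  refine ⟨C, F', G', h1, h2, h3, h4, h5, ?_⟩
  have := mul_le_mul_of_nonneg_left h7 hβ
  linarith

end Step2
end BES
set_option linter.unusedSectionVars false
set_option linter.unusedVariables false
namespace BES
open Finset

lemma iter {V : Type} [Fintype V] [DecidableEq V] (r M : ℕ) (A η κ T : ℝ) (y : ℕ → ℝ)
    (hA : 1 ≤ A) (hη0 : 0 < η) (hη1 : η ≤ 1) (hκ : 0 ≤ κ)
    (hy1 : ∀ m, 1 ≤ y m) (hym : ∀ m, y m ≤ y (m + 1))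
    (hT : ∀ m < M, 2 ≤ (3 / 4) ^ m * T)
    (hp : ∀ m < M, (y (m + 1) - y m) / ((3 / 4) ^ m * T) ≤ 1 / 8)
    (hbl : ∀ m < M, (A * (1 + η) ^ m) * (y (m + 1) ^ r - y m ^ r) ≤ 1 / 8)
    (hη : ∀ m < M, (1 / (1 - (y (m + 1) - y m) / ((3 / 4) ^ m * T))) ^ r ≤ 1 + η / 2)
    (hk : ∀ m < M, κ ≤ 3 / 4 - 8 * r / (η ^ 2 * ((3 / 4) ^ m * T))) :
    ∀ d m : ℕ, m + d = M → ∀ (G : Finset (Finset V)) (F : Finset V),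
      Good G F r (A * (1 + η) ^ m) (y m) ((3 / 4) ^ m * T) →
      ∃ J ⊆ F, (∀ e ∈ G, ¬ e ⊆ J) ∧
        (∑ l ∈ Finset.range d, 7 / 8 * ((y (m + l + 1) - y (m + l)) / ((3 / 4) ^ (m + l) * T)) * κ ^ l)
          * F.card ≤ J.card := by
  intro d
  induction d with
  | zero =>
    intro m _ G F hg
    refine ⟨∅, by simp, ?_, by simp⟩
    intro e he h
    have := hg.two e he
    rw [Finset.subset_empty.1 h] at this
    simp at this
  | succ d ih =>
    intro m hm G F hg
    have hmM : m < M := by omega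
    set p := (y (m + 1) - y m) / ((3 / 4) ^ m * T) with hpdef
    have hTm := hT m hmM
    have hp0 : 0 ≤ p := div_nonneg (by linarith [hym m]) (by linarith)
    have hpT : y m + p * ((3 / 4) ^ m * T) = y (m + 1) := by
      rw [hpdef, div_mul_cancel₀ _ (by linarith)]; ring
    set β := ∑ l ∈ Finset.range d,
      7 / 8 * ((y (m + 1 + l + 1) - y (m + 1 + l)) / ((3 / 4) ^ (m + 1 + l) * T)) * κ ^ l with hβ
    have hTpos : 0 < T := by
      have : (0:ℝ) < (3 / 4) ^ m := by positivity
      by_contra h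
      nlinarith
    have hβ0 : 0 ≤ β := Finset.sum_nonneg fun l _ => by
      have := hym (m + 1 + l)
      have h2 : 0 ≤ (y (m + 1 + l + 1) - y (m + 1 + l)) / ((3 / 4) ^ (m + 1 + l) * T) :=
        div_nonneg (by linarith) (by positivity)
      positivity
    obtain ⟨C, F', G', hC, hF', hCF, hG', hind, hcard⟩ := step hg (p := p) (η := η) (β := β)
      (by nlinarith [one_le_pow₀ (n := m) (show (1:ℝ) ≤ 1 + η by linarith)]) (hy1 m) hTm hp0
      (hp m hmM) (by rw [hpT]; exact hbl m hmM) hη0 hη1 (hη m hmM) hβ0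
    rw [hpT, show A * (1 + η) ^ m * (1 + η) = A * (1 + η) ^ (m + 1) by ring,
      show (3 / 4 : ℝ) * ((3 / 4) ^ m * T) = (3 / 4) ^ (m + 1) * T by ring] at hG'
    obtain ⟨J, hJ, hJi, hJc⟩ := ih (m + 1) (by omega) G' F' hG'
    refine ⟨C ∪ J, Finset.union_subset hC (hJ.trans hF'), hind J hJ hJi, ?_⟩
    rw [Finset.card_union_of_disjoint (hCF.mono_right hJ), Nat.cast_add]
    refine le_trans ?_ (le_trans hcard (by linarith))
    refine mul_le_mul_of_nonneg_right ?_ (Nat.cast_nonneg _)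
    rw [Finset.sum_range_succ']
    have e1 : ∑ l ∈ Finset.range d, 7 / 8 * ((y (m + (l + 1) + 1) - y (m + (l + 1))) /
        ((3 / 4) ^ (m + (l + 1)) * T)) * κ ^ (l + 1) = κ * β := by
      rw [hβ, Finset.mul_sum]
      refine Finset.sum_congr rfl fun l _ => ?_
      rw [show m + (l + 1) = m + 1 + l by ring]
      ring
    rw [e1]
    have := mul_le_mul_of_nonneg_left (hk m hmM) hβ0
    simp only [add_zero, pow_zero, mul_one]
    rw [← hpdef]
    linarith

set_option maxHeartbeats 1000000 in
theorem akpss (r : ℕ) (hr : 1 ≤ r) (A : ℝ) (hA : 1 ≤ A) :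
    ∃ c : ℝ, 0 < c ∧ ∃ T₀ : ℝ, ∀ T : ℝ, T₀ ≤ T → ∀ (V : Type) [Fintype V] [DecidableEq V]
      (G : Finset (Finset V)) (F : Finset V), Good G F r A 1 T →
      ∃ J ⊆ F, (∀ e ∈ G, ¬ e ⊆ J) ∧
        c * (Real.log T) ^ (1 / (r : ℝ)) / T * F.card ≤ J.card := by
  have hr0 : (0:ℝ) < r := by exact_mod_cast hr
  have hr1 : (1:ℝ) ≤ r := by exact_mod_cast hr
  refine ⟨7 / 32 * (1 / (32 * A)) ^ (1 / (r:ℝ)), by positivity, ?_⟩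
  -- eventual conditions in terms of s
  have hlog : ∀ᶠ s : ℝ in Filter.atTop, Real.log s ≤ (1 / 16) * s := by
    have := Real.isLittleO_log_id_atTop.bound (show (0:ℝ) < 1 / 16 by norm_num)
    filter_upwards [this, Filter.eventually_ge_atTop (1:ℝ)] with s hs hs1
    simp only [id, Real.norm_eq_abs] at hs
    rw [abs_of_nonneg (by linarith : (0:ℝ) ≤ s)] at hs
    exact (le_abs_self _).trans hs
  have hlog2 : ∀ᶠ s : ℝ in Filter.atTop, 32 * A * 2 ^ r + 2 ≤ Real.log s :=
    Real.tendsto_log_atTop.eventually_ge_atTop _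
  have hpow : Filter.Tendsto (fun T : ℝ => T ^ (1 / 8 : ℝ)) Filter.atTop Filter.atTop :=
    tendsto_rpow_atTop (by norm_num)
  have hev : ∀ᶠ T : ℝ in Filter.atTop, (1 ≤ T ∧ 32 * A * 2 ^ r + 2 ≤ Real.log T) ∧
      Real.log (T ^ (1 / 8 : ℝ)) ≤ (1 / 16) * T ^ (1 / 8 : ℝ) ∧ 22 * r ≤ T ^ (1 / 8 : ℝ) :=
    ((Filter.eventually_ge_atTop 1).and hlog2).and
      ((hpow.eventually hlog).and (hpow.eventually_ge_atTop (22 * (r:ℝ))))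
  obtain ⟨T₀, hT₀⟩ := Filter.eventually_atTop.1 hev
  refine ⟨T₀, fun T hT V _ _ G F hg => ?_⟩
  obtain ⟨⟨hT1, hL⟩, hs1, hs2⟩ := hT₀ T hT
  set s := T ^ (1 / 8 : ℝ) with hs
  have hTpos : 0 < T := by linarith
  have hs8 : s ^ 8 = T := by
    rw [hs, ← Real.rpow_natCast, ← Real.rpow_mul hTpos.le]; norm_num
  have hs22 : 22 ≤ s := by linarith
  have hspos : 0 < s := by linarith
  have hlogT : Real.log T ≤ s / 2 := by
    rw [← hs8, Real.log_pow]; push_cast; linarith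
  have hAr : 0 < 32 * A * 2 ^ r := by positivity
  set M := ⌊Real.log T⌋₊ with hM
  have hM1 : (M:ℝ) ≤ Real.log T := Nat.floor_le (by linarith)
  have hM2 : Real.log T / 2 ≤ M := by
    have := Nat.lt_floor_add_one (Real.log T)
    rw [← hM] at this
    linarith
  -- T_m bound
  have hTm : ∀ m, m < M → s ^ 4 ≤ (3 / 4) ^ m * T := by
    intro m hm
    have h1 : ((4:ℝ) / 3) ^ m ≤ s ^ 4 := by
      have h2 : (4:ℝ) / 3 ≤ Real.exp (1 / 3) := by
        have := Real.add_one_le_exp (1 / 3 : ℝ); linarith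
      calc ((4:ℝ) / 3) ^ m ≤ (Real.exp (1 / 3)) ^ m := pow_le_pow_left₀ (by norm_num) h2 _
        _ = Real.exp (m * (1 / 3)) := by rw [← Real.exp_nat_mul]
        _ ≤ Real.exp (Real.log (s ^ 4)) := by
            apply Real.exp_le_exp.2
            have : (m:ℝ) ≤ M := by exact_mod_cast hm.le
            have h3 : Real.log T = 8 * Real.log s := by rw [← hs8, Real.log_pow]; push_cast; ring
            rw [Real.log_pow]; push_cast
            nlinarith
        _ = s ^ 4 := Real.exp_log (by positivity)
    have h2 : ((3:ℝ) / 4) ^ m * (4 / 3) ^ m = 1 := by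
      rw [← mul_pow]; norm_num
    have h3 : (0:ℝ) < (3 / 4) ^ m := by positivity
    have h4 : s ^ 8 = s ^ 4 * s ^ 4 := by ring
    rw [← hs8, h4]
    have h5 : (3 / 4 : ℝ) ^ m * s ^ 4 ≥ 1 := by rw [← h2]; exact mul_le_mul_of_nonneg_left h1 h3.le
    have h6 : 0 < s ^ 4 := by positivity
    nlinarith
  obtain ⟨y, hydef⟩ : ∃ y : ℕ → ℝ, ∀ m : ℕ, y m = (1 + m / (16 * A)) ^ (1 / (r:ℝ)) := ⟨_, fun _ => rfl⟩
  have hbase : ∀ m : ℕ, (1:ℝ) ≤ 1 + m / (16 * A) := fun m => by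
    have : (0:ℝ) ≤ m / (16 * A) := by positivity
    linarith
  have hyr : ∀ m, y m ^ r = 1 + m / (16 * A) := fun m => by
    have := hbase m
    rw [hydef]
    rw [← Real.rpow_natCast, ← Real.rpow_mul (by linarith), one_div_mul_cancel hr0.ne', Real.rpow_one]
  have hy1 : ∀ m, 1 ≤ y m := fun m => hydef m ▸ Real.one_le_rpow (hbase m) (by positivity)
  have hym : ∀ m, y m ≤ y (m + 1) := fun m => by
    rw [hydef, hydef]
    refine Real.rpow_le_rpow (by linarith [hbase m]) ?_ (by positivity)
    have : (m:ℝ) / (16 * A) ≤ ((m + 1 : ℕ) : ℝ) / (16 * A) := by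
      apply div_le_div_of_nonneg_right _ (by positivity)
      push_cast; linarith
    linarith
  have hdiff : ∀ m, y (m + 1) ^ r - y m ^ r = 1 / (16 * A) := fun m => by
    rw [hyr, hyr]; push_cast; field_simp; ring
  have hdel : ∀ m, y (m + 1) - y m ≤ 1 := fun m => by
    obtain ⟨q, rfl⟩ : ∃ q, r = q + 1 := ⟨r - 1, by omega⟩
    have h1 := hdiff m
    have h2 : 1 / (16 * A) ≤ 1 := by
      rw [div_le_one (by positivity)]; linarith
    have h3 : y m ^ q ≤ y (m + 1) ^ q := pow_le_pow_left₀ (by linarith [hy1 m]) (hym m) _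
    have h4 : 1 ≤ y (m + 1) ^ q := one_le_pow₀ (hy1 _)
    have h5 : y (m + 1) ^ (q + 1) - y m ^ (q + 1) ≥ y (m + 1) ^ q * (y (m + 1) - y m) := by
      rw [pow_succ, pow_succ]
      nlinarith [hy1 m]
    nlinarith [hym m]
  have hss : 22 * 22 ≤ s * s := by nlinarith
  have hs3 : 22 * 22 * s ≤ s ^ 3 := by
    have e : s ^ 3 = s * s * s := by ring
    rw [e]; exact mul_le_mul_of_nonneg_right hss hspos.le
  have hs4 : 22 * r * (22 * 22) ≤ s ^ 3 := by linarith
  have hs4' : s ^ 3 * s = s ^ 4 := by ring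
  have hpi : ∀ m < M, (y (m + 1) - y m) / ((3 / 4) ^ m * T) ≤ 1 / s ^ 4 := fun m hm => by
    have h1 := hTm m hm
    have h2 : 0 < s ^ 4 := by positivity
    exact div_le_div₀ zero_le_one (hdel m) h2 h1
  have hpi0 : ∀ m, 0 ≤ (y (m + 1) - y m) / ((3 / 4) ^ m * T) := fun m =>
    div_nonneg (by linarith [hym m]) (by positivity)
  set η := 1 / s with hη
  have hη0 : 0 < η := by positivity
  have hη1 : η ≤ 1 := by rw [hη, div_le_one hspos]; linarith
  set κ := 3 / 4 - 8 * r / s ^ 2 with hκ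
  have hs2' : 8 * r / s ^ 2 ≤ 8 * r / (22 * r * s) :=  by
    apply div_le_div_of_nonneg_left (by positivity) (by positivity)
    nlinarith
  have hs2'' : 8 * r / (22 * r * s) ≤ 1 / (2 * s) := by
    rw [div_le_div_iff₀ (by positivity) (by positivity)]
    nlinarith [mul_pos hr0 hspos]
  have hse : 8 * r / s ^ 2 ≤ 1 / (2 * s) := hs2'.trans hs2''
  have hse2 : 1 / (2 * s) ≤ 1 / 4 := by
    apply div_le_div_of_nonneg_left (by norm_num) (by norm_num); linarith
  have hκ0 : 0 ≤ κ := by rw [hκ]; linarith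
  have hMs : (M:ℝ) * (1 / s) ≤ 1 / 2 := by
    rw [mul_one_div, div_le_iff₀ hspos]; linarith
  clear_value s M κ η
  have hrp : r * (1 / s ^ 4) ≤ η / 4 := by
    rw [hη, mul_one_div, div_div, div_le_div_iff₀ (by positivity) (by positivity)]
    nlinarith [mul_pos hr0 hspos]
  have hs44 : 8 ≤ s ^ 4 := by rw [← hs4']; nlinarith
  have key := iter (V := V) r M A η κ T y hA hη0 hη1 hκ0 hy1 hym
    (fun m hm => by
      have := hTm m hm
      linarith)
    (fun m hm => (hpi m hm).trans (by
      exact div_le_div_of_nonneg_left (by norm_num) (by norm_num) hs44))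
    (fun m hm => by
      rw [hdiff]
      have h1 : (1 + η) ^ m ≤ 2 := by
        calc (1 + η) ^ m ≤ (Real.exp η) ^ m :=
              pow_le_pow_left₀ (by linarith) (by linarith [Real.add_one_le_exp η]) _
          _ = Real.exp (m * η) := by rw [← Real.exp_nat_mul]
          _ ≤ Real.exp (1 / 2) := by
              apply Real.exp_le_exp.2
              have : (m:ℝ) ≤ M := by exact_mod_cast hm.le
              calc (m:ℝ) * η ≤ M * η := mul_le_mul_of_nonneg_right this hη0.le
                _ ≤ 1 / 2 := hη ▸ hMs
          _ ≤ 2 := by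
              have h1 : Real.exp (1 / 2) * Real.exp (1 / 2) = Real.exp 1 := by
                rw [← Real.exp_add]; norm_num
              have h2 := Real.exp_one_lt_d9
              by_contra h
              push Not at h
              nlinarith
      have h2 : A * (1 + η) ^ m * (1 / (16 * A)) = (1 + η) ^ m / 16 := by field_simp
      rw [h2]; linarith)
    (fun m hm => by
      set p := (y (m + 1) - y m) / ((3 / 4) ^ m * T) with hp
      have h1 : p ≤ 1 / s ^ 4 := hpi m hm
      have h0 : 0 ≤ p := hpi0 m
      have h2 : r * p ≤ η / 4 := by
        calc r * p ≤ r * (1 / s ^ 4) := mul_le_mul_of_nonneg_left h1 hr0.le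
          _ ≤ η / 4 := hrp
      have hp1 : p ≤ 1 / 4 := by nlinarith
      have h3 : 1 - r * p ≤ (1 - p) ^ r := by
        have := one_add_mul_le_pow (show (-2:ℝ) ≤ -p by linarith) r
        have e : (1 + -p) = 1 - p := by ring
        rw [e] at this; linarith
      rw [one_div_pow, div_le_iff₀ (by apply pow_pos; linarith)]
      nlinarith)
    (fun m hm => by
      have h1 := hTm m hm
      have h2 : s ^ 2 ≤ η ^ 2 * ((3 / 4) ^ m * T) := by
        calc s ^ 2 = η ^ 2 * s ^ 4 := by rw [hη]; field_simp
          _ ≤ _ := mul_le_mul_of_nonneg_left h1 (by positivity)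
      have := div_le_div_of_nonneg_left (show 0 ≤ 8 * (r:ℝ) by positivity) (by positivity) h2
      rw [hκ]; linarith)
    M 0 (by simp) G F (by
      have hy0 : y 0 = 1 := by simp [hydef]
      simpa [hy0] using hg)
  obtain ⟨J, hJ, hJi, hJc⟩ := key
  refine ⟨J, hJ, hJi, le_trans (mul_le_mul_of_nonneg_right ?_ (Nat.cast_nonneg _)) hJc⟩
  have hterm : ∀ l ∈ Finset.range M, 7 / 16 / T * (y (l + 1) - y l) ≤
      7 / 8 * ((y (0 + l + 1) - y (0 + l)) / ((3 / 4) ^ (0 + l) * T)) * κ ^ l := by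
    intro l hl
    rw [Finset.mem_range] at hl
    rw [Nat.zero_add]
    have hk : (1:ℝ) / 2 * (3 / 4) ^ l ≤ κ ^ l := by
      have e1 : κ = (3 / 4) * (1 - 4 / 3 * (8 * r / s ^ 2)) := by rw [hκ]; ring
      rw [e1, mul_pow, mul_comm]
      refine mul_le_mul_of_nonneg_left ?_ (by positivity)
      have h1 := one_add_mul_le_pow (show (-2:ℝ) ≤ -(4 / 3 * (8 * r / s ^ 2)) by linarith) l
      have e2 : 1 + -(4 / 3 * (8 * r / s ^ 2)) = 1 - 4 / 3 * (8 * r / s ^ 2) := by ring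
      rw [e2] at h1
      have h2 : (l:ℝ) ≤ M := by exact_mod_cast hl.le
      have h3 : (l:ℝ) * (8 * r / s ^ 2) ≤ 1 / 4 := by
        calc (l:ℝ) * (8 * r / s ^ 2) ≤ M * (1 / (2 * s)) :=
              mul_le_mul h2 hse (by positivity) (by positivity)
          _ = (M * (1 / s)) / 2 := by field_simp
          _ ≤ 1 / 4 := by linarith
      linarith
    have h34 : (0:ℝ) < (3 / 4) ^ l := by positivity
    have h0 := hpi0 l
    have e3 : 7 / 16 / T * (y (l + 1) - y l) =
        7 / 8 * ((y (l + 1) - y l) / ((3 / 4) ^ l * T)) * (1 / 2 * (3 / 4) ^ l) := by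
      field_simp; ring
    rw [e3]
    exact mul_le_mul_of_nonneg_left hk (by positivity)
  refine le_trans ?_ (Finset.sum_le_sum hterm)
  rw [← Finset.mul_sum, Finset.sum_range_sub]
  have hy0 : y 0 = 1 := by simp [hydef]
  rw [hy0]
  have hyM : (1 / (32 * A)) ^ (1 / (r:ℝ)) * Real.log T ^ (1 / (r:ℝ)) ≤ y M := by
    rw [← Real.mul_rpow (by positivity) (by linarith), hydef]
    have hlT0 : 0 ≤ Real.log T := by linarith
    refine Real.rpow_le_rpow (by positivity) ?_ (by positivity)
    have : Real.log T / 2 / (16 * A) ≤ M / (16 * A) :=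
      div_le_div_of_nonneg_right hM2 (by positivity)
    have e : 1 / (32 * A) * Real.log T = Real.log T / 2 / (16 * A) := by field_simp; ring
    rw [e]; linarith
  have hy2 : 2 ≤ y M := by
    have h1 : (2:ℝ) ^ r ≤ y M ^ r := by
      rw [hyr]
      have : (2:ℝ) ^ r ≤ M / (16 * A) := by
        rw [le_div_iff₀ (by positivity)]; nlinarith
      linarith
    exact le_of_pow_le_pow_left₀ (by omega) (by linarith [hy1 M]) h1
  have e : 7 / 32 * (1 / (32 * A)) ^ (1 / (r:ℝ)) * Real.log T ^ (1 / (r:ℝ)) / T =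
    7 / 32 / T * ((1 / (32 * A)) ^ (1 / (r:ℝ)) * Real.log T ^ (1 / (r:ℝ))) := by ring
  rw [e]
  calc 7 / 32 / T * ((1 / (32 * A)) ^ (1 / (r:ℝ)) * Real.log T ^ (1 / (r:ℝ)))
      ≤ 7 / 32 / T * y M := mul_le_mul_of_nonneg_left hyM (by positivity)
    _ ≤ 7 / 16 / T * (y M - 1) := by
      have : 7 / 16 / T * (y M - 1) = 7 / 32 / T * (2 * (y M - 1)) := by ring
      rw [this]
      exact mul_le_mul_of_nonneg_left (by linarith) (by positivity)

end BES
set_option linter.unusedSectionVars false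
set_option linter.unusedVariables false
namespace BES
open Finset

section app
variable {α : Type} [Fintype α] [DecidableEq α]

def U (S : Finset (Finset α)) : ℕ := (S.biUnion id).card

lemma U_submod (A B : Finset (Finset α)) : U (A ∪ B) + U (A ∩ B) ≤ U A + U B := by
  unfold U
  have h1 : (A ∩ B).biUnion id ⊆ A.biUnion id ∩ B.biUnion id := by
    intro x hx
    simp only [mem_biUnion, mem_inter, id] at hx ⊢
    obtain ⟨e, ⟨h1, h2⟩, h3⟩ := hx
    exact ⟨⟨e, h1, h3⟩, ⟨e, h2, h3⟩⟩
  have h2 := card_union_add_card_inter (A.biUnion id) (B.biUnion id)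
  have h3 := card_le_card h1
  rw [Finset.union_biUnion]
  omega

def Cr (k a b : ℕ) (S : Finset (Finset α)) : Prop := a * U S + b = a * k + S.card * b

instance (k a b : ℕ) (S : Finset (Finset α)) : Decidable (Cr k a b S) := by
  unfold Cr; infer_instance

/-- critical sets closed under union and intersection -/
lemma Cr_lattice {k a b L : ℕ} {F : Finset (Finset α)}
    (hns : ∀ S ⊆ F, 1 ≤ S.card → S.card ≤ L → a * k + S.card * b ≤ a * U S + b)
    {A B : Finset (Finset α)} (hA : A ⊆ F) (hB : B ⊆ F) (hAB : (A ∩ B).Nonempty)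
    (hc : (A ∪ B).card ≤ L) (cA : Cr k a b A) (cB : Cr k a b B) :
    Cr k a b (A ∪ B) ∧ Cr k a b (A ∩ B) := by
  have h1 := hns (A ∪ B) (union_subset hA hB)
    (hAB.card_pos.trans_le (card_le_card (inter_subset_left.trans subset_union_left))) hc
  have h2 := hns (A ∩ B) (inter_subset_left.trans hA) hAB.card_pos
    ((card_le_card (inter_subset_left.trans subset_union_left)).trans hc)
  have h3 := Nat.mul_le_mul_left a (U_submod A B)
  have h4 : (A ∪ B).card * b + (A ∩ B).card * b = A.card * b + B.card * b := by
    rw [← add_mul, ← add_mul, card_union_add_card_inter]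
  unfold Cr at *
  rw [mul_add, mul_add] at h3
  constructor <;> omega

def MinCr (k a b : ℕ) (e : Finset (Finset α)) : Prop :=
  Cr k a b e ∧ 3 ≤ e.card ∧ e.card ≤ a + 1 ∧ ∀ S ⊆ e, 2 ≤ S.card → Cr k a b S → S = e

lemma app_det {k a b : ℕ} (ha : 1 ≤ a) (hab : ¬ a ∣ b) {F : Finset (Finset α)}
    (hk : ∀ e ∈ F, e.card = k)
    (hns : ∀ S ⊆ F, 2 ≤ S.card → S.card ≤ 4 * (a + 1) → a * k + S.card * b ≤ a * U S + b)
    {A T : ℝ} (hA : 0 ≤ A) (hT : 0 ≤ T)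
    (hdeg : ∀ u ∈ F, ∀ s ∈ Icc 2 (a + 1),
      ((F.powerset.filter (fun S => S.card = s ∧ Cr k a b S ∧ u ∈ S)).card : ℝ) ≤ A * T ^ (s - 1)) :
    ∃ G : Finset (Finset (Finset α)), Good G F a A 1 T ∧
      ∀ J ⊆ F, (∀ e ∈ G, ¬ e ⊆ J) → ∀ S ⊆ J, S.card = a + 1 → k + b < U S := by
  classical
  have hns' : ∀ S ⊆ F, 1 ≤ S.card → S.card ≤ 4 * (a + 1) → a * k + S.card * b ≤ a * U S + b := by
    intro S hS h1 h2
    rcases Nat.lt_or_ge 1 S.card with h | h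
    · exact hns S hS h h2
    · obtain ⟨e, he⟩ := card_eq_one.1 (le_antisymm h h1)
      have : U S = k := by
        rw [he, U]; simp [hk e (hS (he ▸ mem_singleton_self e))]
      rw [this]; rw [he]; simp
  have hsz : ∀ S ⊆ F, Cr k a b S → S.card ≠ 2 := by
    intro S hS hc h2
    unfold Cr at hc
    rw [h2] at hc
    apply hab
    have h1 : a * U S = a * k + b := by omega
    exact (Nat.dvd_add_right (dvd_mul_right a k)).1 (h1 ▸ dvd_mul_right a (U S))
  set G := F.powerset.filter (MinCr k a b) with hG
  have mG : ∀ {e}, e ∈ G ↔ e ⊆ F ∧ MinCr k a b e := by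
    intro e; rw [hG, mem_filter, mem_powerset]
  -- intersections of critical sets with minimal ones
  have hint : ∀ B ⊆ F, B.card ≤ 3 * (a + 1) → Cr k a b B → ∀ e ∈ G, 2 ≤ (B ∩ e).card → e ⊆ B := by
    intro B hB hBc cB e he h2
    obtain ⟨heF, ce, he3, hea, hm⟩ := mG.1 he
    have h := (Cr_lattice hns' hB heF (card_pos.1 (by omega))
      ((card_union_le _ _).trans (by omega)) cB ce).2
    have := hm _ inter_subset_right h2 h
    rw [← this]; exact inter_subset_left
  have two : ∀ {B e : Finset (Finset α)} {u v}, u ≠ v → u ∈ B → v ∈ B → u ∈ e → v ∈ e →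
      2 ≤ (B ∩ e).card := by
    intro B e u v huv h1 h2 h3 h4
    exact Finset.one_lt_card.2 ⟨u, mem_inter.2 ⟨h1, h3⟩, v, mem_inter.2 ⟨h2, h4⟩, huv⟩
  have hlin : ∀ e ∈ G, ∀ f ∈ G, ∀ u v, u ≠ v → u ∈ e → v ∈ e → u ∈ f → v ∈ f → e = f := by
    intro e he f hf u v huv h1 h2 h3 h4
    obtain ⟨heF, ce, he3, hea, hm⟩ := mG.1 he
    obtain ⟨hfF, cf, hf3, hfa, hfm⟩ := mG.1 hf
    have h := hint e heF (by omega) ce f hf (two huv h1 h2 h3 h4)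
    exact (hm f h (by omega) cf).symm
  have third : ∀ e ∈ G, ∀ u v, ∃ x ∈ e, x ≠ u ∧ x ≠ v := by
    intro e he u v
    obtain ⟨heF, ce, he3, hea, hm⟩ := mG.1 he
    by_contra h
    push Not at h
    have : e ⊆ {u, v} := by
      intro x hx
      by_cases hxu : x = u
      · simp [hxu]
      · simp [h x hx hxu]
    have := (card_le_card this).trans card_le_two
    omega
  have ua : ∀ e ∈ G, ∀ g ∈ G, ∀ g' ∈ G, g ≠ e → g' ≠ e → ∀ w ∈ e, ∀ w' ∈ e, w ≠ w' →
      w ∈ g → w' ∈ g' → Disjoint g g' := by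
    intro e he g hg g' hg' hge hge' w hw w' hw' hww hwg hwg'
    by_contra hd
    rw [disjoint_iff_inter_eq_empty, ← ne_eq, ← nonempty_iff_ne_empty] at hd
    obtain ⟨hgF, cg, hg3, hga, _⟩ := mG.1 hg
    obtain ⟨hgF', cg', hg3', hga', _⟩ := mG.1 hg'
    have hcu := card_union_le g g'
    have hc := (Cr_lattice hns' hgF hgF' hd (by omega) cg cg').1
    have hsub := hint _ (union_subset hgF hgF') (by omega) hc e he
      (two hww (mem_union_left _ hwg) (mem_union_right _ hwg') hw hw')
    obtain ⟨x, hx, hxw, hxw'⟩ := third e he w w'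
    rcases mem_union.1 (hsub hx) with h | h
    · exact hge (hlin g hg e he x w hxw h hwg hx hw)
    · exact hge' (hlin g' hg' e he x w' hxw' h hwg' hx hw')
  have ub : ∀ e ∈ G, ∀ f ∈ G, ∀ g ∈ G, ∀ g' ∈ G, e ≠ f → g ≠ e → g' ≠ f → ∀ u ∈ e, u ∈ f →
      ∀ w ∈ e, ∀ w' ∈ f, w ≠ u → w' ≠ u → w ∈ g → w' ∈ g' → Disjoint g g' := by
    intro e he f hf g hg g' hg' hef hge hgf u hue huf w hw w' hw' hwu hwu' hwg hwg'
    by_contra hd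
    rw [disjoint_iff_inter_eq_empty, ← ne_eq, ← nonempty_iff_ne_empty] at hd
    obtain ⟨hgF, cg, hg3, hga, _⟩ := mG.1 hg
    obtain ⟨hgF', cg', hg3', hga', _⟩ := mG.1 hg'
    obtain ⟨hfF, cf, hf3, hfa, _⟩ := mG.1 hf
    have hcu := card_union_le g g'
    have hcu' := card_union_le (g ∪ g') f
    have hc := (Cr_lattice hns' hgF hgF' hd (by omega) cg cg').1
    have hc' := (Cr_lattice hns' (union_subset hgF hgF') hfF
      ⟨w', mem_inter.2 ⟨mem_union_right _ hwg', hw'⟩⟩ (by omega) hc cf).1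
    have hsub := hint _ (union_subset (union_subset hgF hgF') hfF) (by omega) hc' e he
      (two hwu (mem_union_left _ (mem_union_left _ hwg)) (mem_union_right _ huf) hw hue)
    obtain ⟨x, hx, hxw, hxu⟩ := third e he w u
    have hge' : g' ≠ e := by
      rintro rfl
      exact hef (hlin _ he _ hf w' u hwu' hwg' hue hw' huf)
    rcases mem_union.1 (hsub hx) with h | h
    · rcases mem_union.1 h with h | h
      · exact hge (hlin g hg e he x w hxw h hwg hx hw)
      · have := ua e he f hf g' hg' hef.symm hge' u hue x hx hxu.symm huf h
        exact Finset.disjoint_left.1 this hw' hwg'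
    · exact hef (hlin e he f hf x u hxu hx hue h huf)
  refine ⟨G, ⟨?_, ?_, ?_, ⟨?_, ?_⟩, ?_⟩, ?_⟩
  · intro e he; exact (mG.1 he).1
  · intro e he; have := (mG.1 he).2.2.1; omega
  · intro e he; exact (mG.1 he).2.2.2.1
  · exact ua
  · exact ub
  · intro u hu s hs
    rw [mem_Icc] at hs
    have h1 := hdeg u hu (s + 1) (mem_Icc.2 ⟨by omega, by omega⟩)
    have h2 : ((St G u).filter (fun e => e.card = s + 1)).card ≤
        (F.powerset.filter (fun S => S.card = s + 1 ∧ Cr k a b S ∧ u ∈ S)).card := by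
      apply card_le_card
      intro e he
      rw [mem_filter, mem_St, mG] at he
      rw [mem_filter, mem_powerset]
      exact ⟨he.1.1.1, he.2, he.1.1.2.1, he.1.2⟩
    have h3 : A * T ^ (s + 1 - 1) ≤ DD a A 1 T s := by
      unfold DD
      rw [Nat.add_sub_cancel, one_pow, mul_one]
      have : (1:ℝ) ≤ a.choose s := by exact_mod_cast Nat.choose_pos hs.2
      nlinarith [mul_nonneg hA (pow_nonneg hT s)]
    calc _ ≤ _ := by exact_mod_cast h2
      _ ≤ _ := h1
      _ ≤ _ := h3
  · intro J hJ hJi S hS hSc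
    by_contra hU
    push Not at hU
    have hSF := hS.trans hJ
    have cS : Cr k a b S := by
      have h1 := hns' S hSF (by omega) (by omega)
      have h2 := Nat.mul_le_mul_left a hU
      unfold Cr
      rw [hSc] at h1 ⊢
      ring_nf at h1 h2 ⊢
      omega
    -- take a minimal critical subset
    have hex : (S.powerset.filter (fun R => 2 ≤ R.card ∧ Cr k a b R)).Nonempty :=
      ⟨S, by rw [mem_filter, mem_powerset]; exact ⟨subset_rfl, by omega, cS⟩⟩
    obtain ⟨R, hR, hmin⟩ := exists_min_image _ card hex
    rw [mem_filter, mem_powerset] at hR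
    have hRF := hR.1.trans hSF
    have hRc := card_le_card hR.1
    have := hsz R hRF hR.2.2
    refine hJi R (mG.2 ⟨hRF, hR.2.2, by omega, by omega, ?_⟩) (hR.1.trans hS)
    intro S' hS' h2 c'
    refine eq_of_subset_of_card_le hS' (hmin S' ?_)
    rw [mem_filter, mem_powerset]
    exact ⟨hS'.trans hR.1, h2, c'⟩

end app
end BES
set_option linter.unusedSectionVars false
set_option linter.unusedVariables false
namespace BES
open Finset

section app
variable {V : Type} [Fintype V] [DecidableEq V]

lemma sample [Nonempty V] (W : Finset V) (p : ℝ) (hp0 : 0 ≤ p) (hp1 : p ≤ 1) (B : Finset (Finset V))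
    (hB : ∀ S ∈ B, S.Nonempty) (I : Finset ℕ) (𝒯 : ℕ → Finset (Finset V))
    (hT : ∀ s ∈ I, ∀ S ∈ 𝒯 s, S.card = s) (D : ℕ → ℝ) (hD : ∀ s, 0 < D s) :
    ∃ X ⊆ W, (∀ S ∈ B, ¬ S ⊆ X) ∧
      (∀ u ∈ X, ∀ s ∈ I, (((𝒯 s).filter (fun S => S ⊆ X ∧ u ∈ S)).card : ℝ) ≤ D s) ∧
      W.card * p - ∑ S ∈ B, p ^ S.card - ∑ s ∈ I, s / D s * ((𝒯 s).card * p ^ s) ≤ X.card := by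
  classical
  let μ : V → Bool → ℝ := fun _ b => if b then p else 1 - p
  have hμ : IsP μ := ⟨fun v b => by cases b <;> simp [μ] <;> linarith, fun v => by simp [μ]⟩
  let ind : Finset V → (V → Bool) → ℝ := fun S ω => ∏ v ∈ S, if ω v then 1 else 0
  have hind : ∀ S, Ex μ (ind S) = p ^ S.card := by
    intro S
    have := Ex_prod hμ S (fun v ω => if ω v then (1:ℝ) else 0) (fun v => {v})
      (fun v _ ω ω' h => by simp [h v (by simp)]) (fun v _ w _ h => by simpa using h)
    rw [show Ex μ (ind S) = _ from this]
    rw [← Finset.prod_const]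
    refine Finset.prod_congr rfl fun v _ => ?_
    rw [Ex_single hμ v (fun b => if b then (1:ℝ) else 0)]
    simp [μ]
  have hind1 : ∀ S ω, ind S ω = if (∀ v ∈ S, ω v = true) then 1 else 0 := by
    intro S ω
    simp only [ind]
    split_ifs with h
    · exact Finset.prod_eq_one fun v hv => by simp [h v hv]
    · push Not at h
      obtain ⟨v, hv, h2⟩ := h
      exact Finset.prod_eq_zero hv (by simp [h2])
  obtain ⟨ω, hω⟩ := Ex_exists hμ (fun ω => ∑ v ∈ W, ind {v} ω - ∑ S ∈ B, ind S ω -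
    ∑ s ∈ I, s / D s * ∑ S ∈ 𝒯 s, ind S ω)
  have hE : Ex μ (fun ω => ∑ v ∈ W, ind {v} ω - ∑ S ∈ B, ind S ω -
      ∑ s ∈ I, s / D s * ∑ S ∈ 𝒯 s, ind S ω) =
      W.card * p - ∑ S ∈ B, p ^ S.card - ∑ s ∈ I, s / D s * ((𝒯 s).card * p ^ s) := by
    rw [Ex_sub, Ex_sub, Ex_sum, Ex_sum, Ex_sum]
    congr 1
    · congr 1
      · rw [Finset.sum_congr rfl (fun v _ => hind {v})]; simp
      · exact Finset.sum_congr rfl (fun v _ => hind v)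
    · refine Finset.sum_congr rfl fun s hs => ?_
      rw [Ex_cmul, Ex_sum]
      congr 1
      rw [Finset.sum_congr rfl (fun S hS => (hind S).trans (by rw [hT s hs S hS]))]
      simp
  rw [hE] at hω
  set X0 := W.filter (fun v => ω v = true) with hX0
  have hsub : ∀ S : Finset V, S ⊆ X0 → ∀ v ∈ S, ω v = true := fun S h v hv =>
    (mem_filter.1 (h hv)).2
  set B0 := B.filter (fun S => S ⊆ X0) with hB0
  choose! pk hpk using hB
  let deg : ℕ → V → ℕ := fun s u => ((𝒯 s).filter (fun S => S ⊆ X0 ∧ u ∈ S)).card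
  set R1 := B0.image pk with hR1
  set R2 := I.biUnion (fun s => X0.filter (fun u => D s < deg s u)) with hR2
  refine ⟨(X0 \ R1) \ R2, ?_, ?_, ?_, ?_⟩
  · exact sdiff_subset.trans (sdiff_subset.trans (filter_subset _ _))
  · intro S hS hSX
    have h1 : S ⊆ X0 := hSX.trans (sdiff_subset.trans sdiff_subset)
    have h2 := hSX (hpk S hS)
    rw [mem_sdiff, mem_sdiff] at h2
    exact h2.1.2 (mem_image_of_mem pk (mem_filter.2 ⟨hS, h1⟩))
  · intro u hu s hs
    rw [mem_sdiff] at hu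
    have h1 : ¬ D s < deg s u := by
      intro h
      exact hu.2 (mem_biUnion.2 ⟨s, hs, mem_filter.2 ⟨(mem_sdiff.1 hu.1).1, h⟩⟩)
    push Not at h1
    refine le_trans ?_ h1
    have : ((𝒯 s).filter (fun S => S ⊆ (X0 \ R1) \ R2 ∧ u ∈ S)).card ≤ deg s u := by
      apply card_le_card
      intro S hS
      rw [mem_filter] at hS ⊢
      exact ⟨hS.1, hS.2.1.trans (sdiff_subset.trans sdiff_subset), hS.2.2⟩
    exact_mod_cast this
  · refine hω.trans ?_
    have c0 : ∑ v ∈ W, ind {v} ω = X0.card := by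
      rw [hX0, Finset.card_filter]
      push_cast
      refine Finset.sum_congr rfl fun v _ => ?_
      rw [hind1]; simp
    have c1 : (R1.card : ℝ) ≤ ∑ S ∈ B, ind S ω := by
      have h1 : (R1.card : ℝ) ≤ B0.card := by exact_mod_cast card_image_le
      refine h1.trans ?_
      rw [hB0, Finset.card_filter]
      push_cast
      refine Finset.sum_le_sum fun S _ => ?_
      rw [hind1]
      split_ifs with h2 h3 <;> first | exact le_rfl | exact zero_le_one | exact absurd (hsub S h2) h3
    have c2 : (R2.card : ℝ) ≤ ∑ s ∈ I, s / D s * ∑ S ∈ 𝒯 s, ind S ω := by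
      have h1 : (R2.card : ℝ) ≤ ∑ s ∈ I, ((X0.filter (fun u => D s < deg s u)).card : ℝ) := by
        exact_mod_cast card_biUnion_le
      refine h1.trans (Finset.sum_le_sum fun s hs => ?_)
      have h2 : ((X0.filter (fun u => D s < deg s u)).card : ℝ) * D s ≤ ∑ u ∈ X0, (deg s u : ℝ) := by
        calc ((X0.filter (fun u => D s < deg s u)).card : ℝ) * D s
            = ∑ u ∈ X0.filter (fun u => D s < deg s u), D s := by simp
          _ ≤ ∑ u ∈ X0.filter (fun u => D s < deg s u), (deg s u : ℝ) :=
            Finset.sum_le_sum fun u hu => (mem_filter.1 hu).2.le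
          _ ≤ _ := Finset.sum_le_sum_of_subset_of_nonneg (filter_subset _ _)
            fun _ _ _ => Nat.cast_nonneg _
      have h3 : ∑ u ∈ X0, (deg s u : ℝ) ≤ s * ∑ S ∈ 𝒯 s, ind S ω := by
        have e : ∀ u, (deg s u : ℝ) = ∑ S ∈ 𝒯 s, if (S ⊆ X0 ∧ u ∈ S) then (1:ℝ) else 0 := by
          intro u
          simp only [deg]
          rw [Finset.card_filter]; push_cast; rfl
        rw [Finset.sum_congr rfl fun u _ => e u, Finset.sum_comm, Finset.mul_sum]
        refine Finset.sum_le_sum fun S hS => ?_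
        by_cases hSX : S ⊆ X0
        · rw [hind1, if_pos (hsub S hSX), mul_one]
          simp only [hSX, true_and]
          rw [← hT s hs S hS, Finset.sum_ite_mem, Finset.sum_const, nsmul_eq_mul, mul_one]
          exact_mod_cast card_le_card inter_subset_right
        · simp only [hSX, false_and, if_false, Finset.sum_const_zero]
          rw [hind1]
          split_ifs <;> simp
      have h4 : (s:ℝ) / D s * ∑ S ∈ 𝒯 s, ind S ω = (s * ∑ S ∈ 𝒯 s, ind S ω) / D s := by ring
      rw [h4, le_div_iff₀ (hD s)]
      exact h2.trans h3
    have c3 : (X0.card : ℝ) ≤ ((X0 \ R1) \ R2).card + R1.card + R2.card := by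
      have h1 := Finset.le_card_sdiff R1 X0
      have h2 := Finset.le_card_sdiff R2 (X0 \ R1)
      have : X0.card ≤ ((X0 \ R1) \ R2).card + R1.card + R2.card := by omega
      exact_mod_cast this
    linarith

end app

section cnt
variable {α : Type} [Fintype α] [DecidableEq α]

lemma count_U (q : ℕ) (𝒜 : Finset (Finset (Finset α))) (h : ∀ S ∈ 𝒜, U S = q) :
    𝒜.card ≤ Fintype.card α ^ q * 2 ^ 2 ^ q := by
  have hs : 𝒜 ⊆ (powersetCard q (univ : Finset α)).biUnion (fun Q => Q.powerset.powerset) := by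
    intro S hS
    rw [mem_biUnion]
    refine ⟨S.biUnion id, ?_, ?_⟩
    · rw [mem_powersetCard]; exact ⟨subset_univ _, h S hS⟩
    · rw [mem_powerset]
      intro e he
      rw [mem_powerset]
      exact subset_biUnion_of_mem id he
  refine (card_le_card hs).trans (card_biUnion_le.trans ?_)
  calc ∑ Q ∈ powersetCard q (univ : Finset α), (Q.powerset.powerset).card
      = ∑ Q ∈ powersetCard q (univ : Finset α), 2 ^ 2 ^ q :=
        Finset.sum_congr rfl fun Q hQ => by
          rw [card_powerset, card_powerset, (mem_powersetCard.1 hQ).2]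
    _ = (Fintype.card α).choose q * 2 ^ 2 ^ q := by
        rw [Finset.sum_const, card_powersetCard, card_univ, smul_eq_mul]
    _ ≤ _ := Nat.mul_le_mul_right _ (Nat.choose_le_pow _ _)

lemma U_le {k : ℕ} {S : Finset (Finset α)} (h : ∀ e ∈ S, e.card = k) : U S ≤ S.card * k := by
  unfold U
  exact card_biUnion_le_card_mul _ _ _ fun e he => (h e he).le

end cnt
end BES
set_option linter.unusedSectionVars false
set_option linter.unusedVariables false
namespace BES
open Finset

lemma exp_sub {a b k q s : ℕ} (ha : 1 ≤ a) (x : ℝ) (hx : 1 ≤ x)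
    (hs : 1 ≤ s) (hs4 : s ≤ 4 * (a + 1)) (h : a * q + b < a * k + s * b) :
    x ^ q * (x ^ (1 / (8 * ((a:ℝ) + 1) ^ 2) - (b:ℝ) / a)) ^ s ≤
      x ^ k * x ^ (1 / (8 * ((a:ℝ) + 1) ^ 2) - (b:ℝ) / a) * x ^ (-(1 / (2 * ((a:ℝ) + 1)))) := by
  have hx0 : 0 < x := by linarith
  have ha0 : (0:ℝ) < a := by exact_mod_cast ha
  rw [← Real.rpow_natCast x q, ← Real.rpow_natCast x k, ← Real.rpow_natCast _ s,
    ← Real.rpow_mul hx0.le, ← Real.rpow_add hx0, ← Real.rpow_add hx0, ← Real.rpow_add hx0]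
  refine Real.rpow_le_rpow_of_exponent_le hx ?_
  have h1 : (a:ℝ) * q + b + 1 ≤ a * k + s * b := by exact_mod_cast h
  have hs' : (s:ℝ) ≤ 4 * (a + 1) := by exact_mod_cast hs4
  have h2 : (q:ℝ) + 1 / a ≤ k + (s - 1) * (b / a) := by
    have e : (k:ℝ) + (s - 1) * (b / a) - (q + 1 / a) = (a * k + s * b - (a * q + b + 1)) / a := by
      field_simp; ring
    have : 0 ≤ (k:ℝ) + (s - 1) * (b / a) - (q + 1 / a) := by
      rw [e]; exact div_nonneg (by linarith) ha0.le
    linarith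
  have h3 : (s - 1) * (1 / (8 * ((a:ℝ) + 1) ^ 2)) ≤ 1 / (2 * ((a:ℝ) + 1)) := by
    rw [mul_one_div, div_le_div_iff₀ (by positivity) (by positivity)]
    nlinarith
  have h4 : 1 / (2 * ((a:ℝ) + 1)) + 1 / (2 * ((a:ℝ) + 1)) ≤ 1 / a := by
    have e : 1 / (2 * ((a:ℝ) + 1)) + 1 / (2 * ((a:ℝ) + 1)) = 1 / (a + 1) := by field_simp; norm_num
    rw [e]
    exact one_div_le_one_div_of_le ha0 (by linarith)
  generalize 1 / (8 * ((a:ℝ) + 1) ^ 2) = ε at *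
  generalize (b:ℝ) / a = σ at *
  generalize 1 / (2 * ((a:ℝ) + 1)) = δ at *
  linarith

lemma exp_eq {a b k q s : ℕ} (ha : 1 ≤ a) (x : ℝ) (hx : 1 ≤ x)
    (hs : 1 ≤ s) (h : a * q + b = a * k + s * b) :
    x ^ q * (x ^ (1 / (8 * ((a:ℝ) + 1) ^ 2) - (b:ℝ) / a)) ^ s =
      x ^ k * x ^ (1 / (8 * ((a:ℝ) + 1) ^ 2) - (b:ℝ) / a) * (x ^ (1 / (8 * ((a:ℝ) + 1) ^ 2))) ^ (s - 1) := by
  have hx0 : 0 < x := by linarith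
  have ha0 : (0:ℝ) < a := by exact_mod_cast ha
  rw [← Real.rpow_natCast x q, ← Real.rpow_natCast x k, ← Real.rpow_natCast _ s,
    ← Real.rpow_natCast _ (s - 1),
    ← Real.rpow_mul hx0.le, ← Real.rpow_mul hx0.le, ← Real.rpow_add hx0, ← Real.rpow_add hx0,
    ← Real.rpow_add hx0]
  congr 1
  have h1 : (a:ℝ) * q + b = a * k + s * b := by exact_mod_cast h
  have h2 : (q:ℝ) = k + (s - 1) * (b / a) := by
    field_simp; linarith
  rw [Nat.cast_sub hs, h2]
  push_cast
  ring

lemma select (k a b : ℕ) (ha : 1 ≤ a) (hb : 1 ≤ b) :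
    ∃ A : ℝ, 1 ≤ A ∧ ∃ c : ℝ, 0 < c ∧ ∃ N : ℕ, ∀ n : ℕ, N ≤ n →
      ∃ F : Finset (Finset (Fin n)), (∀ e ∈ F, e.card = k) ∧
        (∀ S ⊆ F, 2 ≤ S.card → S.card ≤ 4 * (a + 1) → a * k + S.card * b ≤ a * U S + b) ∧
        (∀ u ∈ F, ∀ s ∈ Icc 2 (a + 1),
          ((F.powerset.filter (fun S => S.card = s ∧ Cr k a b S ∧ u ∈ S)).card : ℝ) ≤
            A * ((n:ℝ) ^ (1 / (8 * ((a:ℝ) + 1) ^ 2))) ^ (s - 1)) ∧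
        c * ((n:ℝ) ^ k * (n:ℝ) ^ (1 / (8 * ((a:ℝ) + 1) ^ 2) - (b:ℝ) / a)) ≤ F.card := by
  have ha0 : (0:ℝ) < a := by exact_mod_cast ha
  obtain ⟨c0, hc0⟩ : ∃ c0 : ℝ, c0 = 1 / (2 ^ k * k.factorial) := ⟨_, rfl⟩
  have hc0p : 0 < c0 := by rw [hc0]; positivity
  have hc01 : c0 ≤ 1 := by
    rw [hc0, div_le_one (by positivity)]
    have h1 : (1:ℝ) ≤ 2 ^ k := one_le_pow₀ (by norm_num)
    have h2 : (1:ℝ) ≤ k.factorial := by exact_mod_cast k.factorial_pos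
    nlinarith
  obtain ⟨K, hK⟩ : ∃ K : ℝ, K = 2 ^ 2 ^ (4 * (a + 1) * k) := ⟨_, rfl⟩
  have hK1 : 1 ≤ K := by rw [hK]; exact one_le_pow₀ (by norm_num)
  obtain ⟨A, hAd⟩ : ∃ A : ℝ, A = 4 * ((a:ℝ) + 1) ^ 2 * K / c0 := ⟨_, rfl⟩
  have hA : 1 ≤ A := by
    rw [hAd, le_div_iff₀ hc0p]
    have : (1:ℝ) ≤ (a + 1) ^ 2 := by nlinarith
    nlinarith
  obtain ⟨Q, hQ⟩ : ∃ Q : Finset (ℕ × ℕ), Q = Icc 2 (4 * (a + 1)) ×ˢ range (4 * (a + 1) * k + 1) :=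
    ⟨_, rfl⟩
  have hev : ∀ᶠ n : ℕ in Filter.atTop,
      Q.card * K * (n:ℝ) ^ (-(1 / (2 * ((a:ℝ) + 1)))) ≤ c0 / 4 := by
    have h1 : Filter.Tendsto (fun x : ℝ => x ^ (-(1 / (2 * ((a:ℝ) + 1))))) Filter.atTop (nhds 0) :=
      tendsto_rpow_neg_atTop (by positivity)
    have h2 := ((h1.comp tendsto_natCast_atTop_atTop).const_mul ((Q.card:ℝ) * K))
    rw [mul_zero] at h2
    exact h2.eventually_le_const (by positivity)
  obtain ⟨N, hN⟩ := Filter.eventually_atTop.1 hev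
  refine ⟨A, hA, c0 / 2, by positivity, max N (2 * k + 1), fun n hn => ?_⟩
  have hn1 := hN n ((le_max_left _ _).trans hn)
  have hnk : 2 * k + 1 ≤ n := (le_max_right _ _).trans hn
  obtain ⟨x, hx⟩ : ∃ x : ℝ, x = (n:ℝ) := ⟨_, rfl⟩
  have hx1 : 1 ≤ x := by rw [hx]; exact_mod_cast (by omega : 1 ≤ n)
  have hx0 : 0 < x := by linarith
  rw [← hx] at hn1 ⊢
  have hS1 := @exp_sub a b k
  have hS2 := @exp_eq a b k
  obtain ⟨p, hp⟩ : ∃ p : ℝ, p = x ^ (1 / (8 * ((a:ℝ) + 1) ^ 2) - (b:ℝ) / a) := ⟨_, rfl⟩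
  obtain ⟨T, hT⟩ : ∃ T : ℝ, T = x ^ (1 / (8 * ((a:ℝ) + 1) ^ 2)) := ⟨_, rfl⟩
  have hp0 : 0 < p := by rw [hp]; positivity
  have hT0 : 0 < T := by rw [hT]; positivity
  have hp1 : p ≤ 1 := by
    rw [hp]
    refine Real.rpow_le_one_of_one_le_of_nonpos hx1 ?_
    have h1 : (1:ℝ) / a ≤ b / a := by
      apply div_le_div_of_nonneg_right _ ha0.le
      exact_mod_cast hb
    have h2 : 1 / (8 * ((a:ℝ) + 1) ^ 2) ≤ 1 / a := one_div_le_one_div_of_le ha0 (by nlinarith)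
    linarith
  replace hS1 := fun q s h1 h2 h3 => @hS1 q s ha x hx1 h1 h2 h3
  replace hS2 := fun q s h1 h2 => @hS2 q s ha x hx1 h1 h2
  rw [← hp] at hS1 hS2 ⊢
  rw [← hT] at hS2 ⊢
  obtain ⟨y, hy⟩ : ∃ y : ℝ, y = x ^ (-(1 / (2 * ((a:ℝ) + 1)))) := ⟨_, rfl⟩
  have hy0 : 0 < y := by rw [hy]; positivity
  rw [← hy] at hS1 hn1
  let W : Finset (Finset (Fin n)) := powersetCard k univ
  have hW : ∀ e ∈ W, e.card = k := fun e he => (mem_powersetCard.1 he).2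
  let B : Finset (Finset (Finset (Fin n))) := W.powerset.filter (fun S =>
    2 ≤ S.card ∧ S.card ≤ 4 * (a + 1) ∧ a * U S + b < a * k + S.card * b)
  let 𝒯 : ℕ → Finset (Finset (Finset (Fin n))) := fun s => W.powerset.filter (fun S =>
    S.card = s ∧ Cr k a b S)
  have hxk : 0 < x ^ k := by positivity
  -- counting
  have hcount : ∀ q ≤ 4 * (a + 1) * k, ∀ 𝒜 : Finset (Finset (Finset (Fin n))),
      (∀ S ∈ 𝒜, U S = q) → (𝒜.card : ℝ) ≤ K * x ^ q := by
    intro q hq 𝒜 h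
    have h1 := count_U q 𝒜 h
    rw [Fintype.card_fin] at h1
    have h2 : (2:ℕ) ^ 2 ^ q ≤ 2 ^ 2 ^ (4 * (a + 1) * k) :=
      Nat.pow_le_pow_right (by norm_num) (Nat.pow_le_pow_right (by norm_num) hq)
    have h3 : 𝒜.card ≤ 2 ^ 2 ^ (4 * (a + 1) * k) * n ^ q := by
      refine h1.trans ?_
      rw [mul_comm]
      exact Nat.mul_le_mul_right _ h2
    rw [hK, hx]
    exact_mod_cast h3
  have hUq : ∀ S ⊆ W, S.card ≤ 4 * (a + 1) → U S ≤ 4 * (a + 1) * k := fun S hS h =>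
    (U_le fun e he => hW e (hS he)).trans (Nat.mul_le_mul_right _ h)
  have hBsum : ∑ S ∈ B, p ^ S.card ≤ Q.card * (K * (x ^ k * p * y)) := by
    have hmap : ∀ S ∈ B, (S.card, U S) ∈ Q := by
      intro S hS
      rw [mem_filter, mem_powerset] at hS
      rw [hQ, mem_product, mem_Icc, mem_range]
      exact ⟨⟨hS.2.1, hS.2.2.1⟩, Nat.lt_succ_of_le (hUq S hS.1 hS.2.2.1)⟩
    rw [← Finset.sum_fiberwise_of_maps_to hmap, ← nsmul_eq_mul]
    refine Finset.sum_le_card_nsmul _ _ _ fun sq hsq => ?_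
    obtain ⟨s, q⟩ := sq
    rcases (B.filter (fun S => (S.card, U S) = (s, q))).eq_empty_or_nonempty with he | ⟨S, hS⟩
    · rw [he, Finset.sum_empty]; positivity
    · rw [mem_filter, mem_filter, mem_powerset, Prod.mk.injEq] at hS
      obtain ⟨⟨hSW, h2, h4, hlt⟩, rfl, rfl⟩ := hS
      have e1 : ∑ R ∈ B.filter (fun R => (R.card, U R) = (S.card, U S)), p ^ R.card =
          (B.filter (fun R => (R.card, U R) = (S.card, U S))).card * p ^ S.card := by
        rw [← nsmul_eq_mul, ← Finset.sum_const]
        refine Finset.sum_congr rfl fun R hR => ?_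
        rw [mem_filter, Prod.mk.injEq] at hR
        rw [hR.2.1]
      rw [e1]
      have h5 := hcount (U S) (hUq S hSW h4) (B.filter (fun R => (R.card, U R) = (S.card, U S)))
        (fun R hR => by rw [mem_filter, Prod.mk.injEq] at hR; exact hR.2.2)
      calc _ ≤ (K * x ^ (U S)) * p ^ S.card := mul_le_mul_of_nonneg_right h5 (by positivity)
        _ = K * (x ^ (U S) * p ^ S.card) := by ring
        _ ≤ _ := mul_le_mul_of_nonneg_left (hS1 _ _ (by omega) h4 hlt) (by linarith)
  have hTc : ∀ s ∈ Icc 2 (a + 1), ((𝒯 s).card : ℝ) * p ^ s ≤ K * (x ^ k * p * T ^ (s - 1)) := by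
    intro s hs
    rw [mem_Icc] at hs
    rcases (𝒯 s).eq_empty_or_nonempty with he | ⟨S, hS⟩
    · rw [he, card_empty, Nat.cast_zero, zero_mul]; positivity
    · rw [mem_filter, mem_powerset] at hS
      obtain ⟨hSW, hSs, hc⟩ := hS
      have h5 := hcount (U S) (hUq S hSW (by omega)) (𝒯 s) (fun R hR => by
        rw [mem_filter, mem_powerset] at hR
        have h1 := hR.2.2
        unfold Cr at h1 hc
        rw [hR.2.1] at h1
        rw [hSs] at hc
        exact Nat.eq_of_mul_eq_mul_left ha (by omega))
      unfold Cr at hc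
      rw [hSs] at hc
      calc _ ≤ (K * x ^ (U S)) * p ^ s := mul_le_mul_of_nonneg_right h5 (by positivity)
        _ = K * (x ^ (U S) * p ^ s) := by ring
        _ = _ := by rw [hS2 _ _ (by omega) hc]
  obtain ⟨X, hXW, hXB, hXd, hXc⟩ := sample W p hp0.le hp1 B
    (fun S hS => by
      rw [mem_filter] at hS
      exact card_pos.1 (by omega)) (Icc 2 (a + 1)) 𝒯
    (fun s hs S hS => by rw [mem_filter] at hS; exact hS.2.1)
    (fun s => A * T ^ (s - 1)) (fun s => by positivity)
  refine ⟨X, fun e he => hW e (hXW he), ?_, ?_, ?_⟩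
  · intro S hS h2 h4
    by_contra hc
    push Not at hc
    exact hXB S (by
      rw [mem_filter, mem_powerset]
      exact ⟨hS.trans hXW, h2, h4, hc⟩) hS
  · intro u hu s hs
    refine le_trans ?_ (hXd u hu s hs)
    have : (X.powerset.filter (fun S => S.card = s ∧ Cr k a b S ∧ u ∈ S)).card ≤
        ((𝒯 s).filter (fun S => S ⊆ X ∧ u ∈ S)).card := by
      apply card_le_card
      intro S hS
      rw [mem_filter, mem_powerset] at hS
      rw [mem_filter, mem_filter, mem_powerset]
      exact ⟨⟨hS.1.trans hXW, hS.2.1, hS.2.2.1⟩, hS.1, hS.2.2.2⟩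
    exact_mod_cast this
  · refine le_trans ?_ hXc
    have hWc : c0 * x ^ k ≤ W.card := by
      have h1 : W.card = n.choose k := by
        simp only [W]; rw [card_powersetCard, card_univ, Fintype.card_fin]
      rw [h1]
      refine le_trans ?_ (Nat.pow_le_choose (α := ℝ) k n)
      have h2 : x / 2 ≤ ((n + 1 - k : ℕ) : ℝ) := by
        rw [Nat.cast_sub (by omega), hx]
        have : (2:ℝ) * k + 1 ≤ n := by exact_mod_cast hnk
        push_cast; linarith
      have h3 := pow_le_pow_left₀ (by positivity) h2 k
      calc c0 * x ^ k = (x / 2) ^ k / k.factorial := by rw [hc0, div_pow]; field_simp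
        _ ≤ _ := div_le_div_of_nonneg_right h3 (by positivity)
    have h1 : c0 * x ^ k * p ≤ W.card * p := mul_le_mul_of_nonneg_right hWc hp0.le
    have hxp : 0 < x ^ k * p := by positivity
    have h2 : (Q.card : ℝ) * (K * (x ^ k * p * y)) ≤ c0 / 4 * (x ^ k * p) := by
      have := mul_le_mul_of_nonneg_right hn1 hxp.le
      linarith
    have h3 : ∑ s ∈ Icc 2 (a + 1), (s:ℝ) / (A * T ^ (s - 1)) * ((𝒯 s).card * p ^ s) ≤
        c0 / 4 * (x ^ k * p) := by
      have : ∀ s ∈ Icc 2 (a + 1), (s:ℝ) / (A * T ^ (s - 1)) * ((𝒯 s).card * p ^ s) ≤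
          (a + 1) * K / A * (x ^ k * p) := by
        intro s hs
        have h4 := hTc s hs
        rw [mem_Icc] at hs
        have h5 : (s:ℝ) ≤ a + 1 := by exact_mod_cast hs.2
        calc (s:ℝ) / (A * T ^ (s - 1)) * ((𝒯 s).card * p ^ s)
            ≤ (s:ℝ) / (A * T ^ (s - 1)) * (K * (x ^ k * p * T ^ (s - 1))) :=
              mul_le_mul_of_nonneg_left h4 (by positivity)
          _ = s * (K / A * (x ^ k * p)) := by field_simp
          _ ≤ (a + 1) * (K / A * (x ^ k * p)) := mul_le_mul_of_nonneg_right h5 (by positivity)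
          _ = _ := by ring
      refine (Finset.sum_le_card_nsmul _ _ _ this).trans ?_
      rw [nsmul_eq_mul, Nat.card_Icc]
      have h6 : ((a + 1 + 1 - 2 : ℕ) : ℝ) ≤ a + 1 := by
        have : a + 1 + 1 - 2 ≤ a + 1 := by omega
        exact_mod_cast this
      calc ((a + 1 + 1 - 2 : ℕ) : ℝ) * ((a + 1) * K / A * (x ^ k * p))
          ≤ (a + 1) * ((a + 1) * K / A * (x ^ k * p)) :=
            mul_le_mul_of_nonneg_right h6 (by positivity)
        _ = c0 / 4 * (x ^ k * p) := by rw [hAd]; field_simp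
    linarith

end BES
namespace BES
open Finset

lemma besF_ge {k n j i : ℕ} (J : Finset (Finset (Fin n))) (hJ : ∀ e ∈ J, e.card = k)
    (h : ∀ S ⊆ J, S.card = i → j < U S) : J.card ≤ besF k n j i := by
  unfold besF
  refine le_csInf ?_ ?_
  · refine ⟨(univ : Finset (Finset (Fin n))).card + 1, ?_⟩
    intro H _ hc
    have := card_le_card (subset_univ H)
    omega
  · intro m hm
    by_contra hlt
    push Not at hlt
    obtain ⟨H, hHJ, hHc⟩ := exists_subset_card_eq hlt.le
    obtain ⟨S, hS, hi⟩ := hm H (fun e he => hJ e (hHJ he)) hHc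
    obtain ⟨R, hR, hRc⟩ := exists_subset_card_eq hi
    have h1 := h R (hR.trans ((filter_subset _ _).trans hHJ)) hRc
    have h2 : U R ≤ S.card := by
      unfold U
      apply card_le_card
      rw [biUnion_subset]
      intro e he
      exact (mem_filter.1 (hR he)).2
    omega

theorem main (k a b : ℕ) (ha : 1 ≤ a) (hab : ¬ a ∣ b) :
    ∃ c : ℝ, 0 < c ∧ ∃ N : ℕ, ∀ n : ℕ, N ≤ n →
      c * ((n : ℝ) ^ ((k:ℝ) - b / a) * (Real.log n) ^ (1 / (a:ℝ))) ≤
        (besF k n (k + b) (a + 1) : ℝ) := by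
  have hb : 1 ≤ b := by
    rcases Nat.eq_zero_or_pos b with h | h
    · exact absurd (h ▸ dvd_zero a) hab
    · exact h
  have ha0 : (0:ℝ) < a := by exact_mod_cast ha
  obtain ⟨A, hA, c1, hc1, N1, hsel⟩ := select k a b ha hb
  obtain ⟨c2, hc2, T₀, hak⟩ := akpss a ha A hA
  obtain ⟨ε, hε⟩ : ∃ ε : ℝ, ε = 1 / (8 * ((a:ℝ) + 1) ^ 2) := ⟨_, rfl⟩
  have hε0 : 0 < ε := by rw [hε]; positivity
  rw [← hε] at hsel
  have hev : ∀ᶠ n : ℕ in Filter.atTop, T₀ ≤ (n:ℝ) ^ ε :=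
    ((tendsto_rpow_atTop hε0).comp tendsto_natCast_atTop_atTop).eventually_ge_atTop T₀
  obtain ⟨N2, hN2⟩ := Filter.eventually_atTop.1 hev
  refine ⟨c2 * ε ^ (1 / (a:ℝ)) * c1, by positivity, max (max N1 N2) 1, fun n hn => ?_⟩
  have hn1 : N1 ≤ n := ((le_max_left _ _).trans (le_max_left _ _)).trans hn
  have hn2 : N2 ≤ n := ((le_max_right _ _).trans (le_max_left _ _)).trans hn
  have hn3 : 1 ≤ n := (le_max_right _ _).trans hn
  have hx1 : (1:ℝ) ≤ n := by exact_mod_cast hn3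
  have hx0 : (0:ℝ) < n := by linarith
  obtain ⟨F, hFk, hFns, hFd, hFc⟩ := hsel n hn1
  have hT0 : (0:ℝ) < (n:ℝ) ^ ε := by positivity
  obtain ⟨G, hG, hGJ⟩ := app_det ha hab hFk hFns (by linarith) hT0.le hFd
  obtain ⟨J, hJF, hJi, hJc⟩ := hak _ (hN2 n hn2) _ G F hG
  have h1 := besF_ge J (fun e he => hFk e (hJF he)) (hGJ J hJF hJi)
  have h2 : (J.card : ℝ) ≤ besF k n (k + b) (a + 1) := by exact_mod_cast h1
  refine le_trans ?_ (hJc.trans h2)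
  have hlog : 0 ≤ Real.log n := Real.log_nonneg hx1
  rw [Real.log_rpow hx0, Real.mul_rpow hε0.le hlog]
  have hnn : 0 ≤ c2 * (ε ^ (1 / (a:ℝ)) * Real.log n ^ (1 / (a:ℝ))) / (n:ℝ) ^ ε := by positivity
  refine le_trans (le_of_eq ?_) (mul_le_mul_of_nonneg_left hFc hnn)
  have e : (n:ℝ) ^ ((k:ℝ) - b / a) * (n:ℝ) ^ ε = (n:ℝ) ^ k * (n:ℝ) ^ (ε - (b:ℝ) / a) := by
    rw [← Real.rpow_natCast (n:ℝ) k, ← Real.rpow_add hx0, ← Real.rpow_add hx0]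
    congr 1; ring
  rw [← e]
  field_simp

end BES

/-- Theorem 1.8: for fixed `i, j, k` with `k·i - j` not divisible by
`i - 1`, `F^(k)(n; j, i) = Ω((n^{k·i-j} · log n)^{1/(i-1)})`. -/
theorem stmt13 (k j i : ℕ) (hk : 2 ≤ k) (hjk : k ≤ j) (hi : 2 ≤ i)
    (hnd : ¬ ((i - 1) ∣ (k * i - j))) :
    ∃ c : ℝ, 0 < c ∧ ∃ N : ℕ, ∀ n : ℕ, N ≤ n →
      c * ((n : ℝ) ^ ((k * i - j : ℕ) : ℝ) * Real.log n) ^ (1 / ((i : ℝ) - 1)) ≤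
        (besF k n j i : ℝ) := by
  obtain ⟨a, rfl⟩ : ∃ a, i = a + 1 := ⟨i - 1, by omega⟩
  obtain ⟨b, rfl⟩ : ∃ b, j = k + b := ⟨j - k, by omega⟩
  rw [Nat.add_sub_cancel] at hnd
  have e0 : k * (a + 1) - (k + b) = a * k - b := by
    rw [mul_add, mul_one, mul_comm k a]; omega
  rw [e0] at hnd ⊢
  have hlt : b < a * k := by
    by_contra h
    exact hnd (by rw [Nat.sub_eq_zero_of_le (by omega)]; exact dvd_zero _)
  have hab : ¬ a ∣ b := fun h => hnd (Nat.dvd_sub (dvd_mul_right a k) h)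
  have ha0 : (0:ℝ) < a := by exact_mod_cast (by omega : 0 < a)
  obtain ⟨c, hc, N, hN⟩ := BES.main k a b (by omega) hab
  refine ⟨c, hc, max N 1, fun n hn => ?_⟩
  have hx1 : (1:ℝ) ≤ n := by exact_mod_cast (le_max_right _ _).trans hn
  refine le_trans (le_of_eq ?_) (hN n ((le_max_left _ _).trans hn))
  congr 1
  have e1 : ((a + 1 : ℕ) : ℝ) - 1 = a := by push_cast; ring
  rw [e1, Real.mul_rpow (by positivity) (Real.log_nonneg hx1), ← Real.rpow_mul (by positivity)]
  congr 2
  rw [Nat.cast_sub hlt.le]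
  push_cast
  field_simp
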